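/- arXiv:1603.07841 — 2 statements merged into one kernel-verified Lean document; each statement's English description precedes it below -/
import Mathlib

section
/- Let G be a special Lipschitz domain with constant M ≥ 1, let φ₀ ∈ D(−K) have nonzero integral, and let φ := φ₀ − 2^{−n}φ₀(·/2). Then for every L ∈ ℕ₀ there exist functions ψ₀, ψ ∈ D(−K) with L_ψ ≥ L such that for every f ∈ D'(G): f = Σ_{k=0}^{∞} ψ_k ∗ φ_k ∗ f with convergence in D'(G), where ψ_k := 2^{kn}ψ(2^k·) and φ_k := 2^{kn}φ(2^k·) for k ≥ 1 and the k = 0 term is ψ₀ ∗ φ₀ ∗ f (all convolutions are well defined on G because the kernels are supported in −K, so that x + K ⊂ G for x ∈ G). -/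
open MeasureTheory ENNReal Filter Topology

noncomputable section

def lqNorm (q : ℝ≥0∞) (a : ℕ → ℝ≥0∞) : ℝ≥0∞ :=
  if q = ∞ then ⨆ k, a k else (∑' k, a k ^ q.toReal) ^ (1 / q.toReal)

def lpSum {ι : Type*} (p : ℝ≥0∞) (a : ι → ℝ≥0∞) : ℝ≥0∞ :=
  if p = ∞ then ⨆ m, a m else (∑' m, a m ^ p.toReal) ^ (1 / p.toReal)

def dyadicCube (n k : ℕ) (m : Fin n → ℤ) : Set (Fin n → ℝ) :=
  {x | ∀ i, (m i : ℝ) / 2 ^ k ≤ x i ∧ x i ≤ ((m i : ℝ) + 1) / 2 ^ k}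

def dilatedCube (n : ℕ) (c : ℝ) (k : ℕ) (m : Fin n → ℤ) : Set (Fin n → ℝ) :=
  {x | ∀ i, |x i - ((m i : ℝ) + 1 / 2) / 2 ^ k| ≤ c / (2 * 2 ^ k)}

def tkm (n : ℕ) (p : ℝ≥0∞) (t : ℕ → (Fin n → ℝ) → ℝ) (k : ℕ) (m : Fin n → ℤ) : ℝ≥0∞ :=
  eLpNorm (t k) p (volume.restrict (dyadicCube n k m))

def PAdmissible (n : ℕ) (p : ℝ≥0∞) (t : ℕ → (Fin n → ℝ) → ℝ) : Prop :=
  (∀ k, Measurable (t k)) ∧ (∀ k, ∀ᵐ x : Fin n → ℝ, 0 < t k x) ∧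
    ∀ k m, tkm n p t k m < ∞

def MemX (n : ℕ) (p σ₁ σ₂ : ℝ≥0∞) (α₁ α₂ α₃ : ℝ) (t : ℕ → (Fin n → ℝ) → ℝ) : Prop :=
  PAdmissible n p t ∧
  (∃ C₁ : ℝ, 0 < C₁ ∧ ∀ k j : ℕ, k ≤ j → ∀ m : Fin n → ℤ,
    (((2 : ℝ≥0∞) ^ (k * n)) ^ p⁻¹.toReal * tkm n p t k m) *
      (((2 : ℝ≥0∞) ^ (k * n)) ^ σ₁⁻¹.toReal *
        eLpNorm (fun x => (t j x)⁻¹) σ₁ (volume.restrict (dyadicCube n k m)))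
      ≤ ENNReal.ofReal (C₁ * 2 ^ (α₁ * ((k : ℝ) - (j : ℝ))))) ∧
  (∃ C₂ : ℝ, 0 < C₂ ∧ ∀ k j : ℕ, k ≤ j → ∀ m : Fin n → ℤ,
    ((2 : ℝ≥0∞) ^ (k * n)) ^ σ₂⁻¹.toReal *
        eLpNorm (t j) σ₂ (volume.restrict (dyadicCube n k m))
      ≤ ENNReal.ofReal (C₂ * 2 ^ (α₂ * ((j : ℝ) - (k : ℝ)))) *
        (((2 : ℝ≥0∞) ^ (k * n)) ^ p⁻¹.toReal * tkm n p t k m)) ∧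
  (∀ k m, 0 < tkm n p t k m) ∧
  (∀ (k : ℕ) (m m' : Fin n → ℤ), (∀ i, |m i - m' i| ≤ 1) →
    tkm n p t k m ≤ ENNReal.ofReal (2 ^ α₃) * tkm n p t k m')

def tbar (n : ℕ) (p : ℝ≥0∞) (t : ℕ → (Fin n → ℝ) → ℝ) (k : ℕ) (x : Fin n → ℝ) : ℝ :=
  (2 : ℝ) ^ (((k * n : ℕ) : ℝ) / p.toReal) * (tkm n p t k fun i => ⌊x i * 2 ^ k⌋).toReal

abbrev Dstrb (n : ℕ) := ((Fin n → ℝ) → ℝ) →ₗ[ℝ] ℝ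

def distConv (n : ℕ) (f : Dstrb n) (φ : (Fin n → ℝ) → ℝ) (x : Fin n → ℝ) : ℝ :=
  f fun y => φ (x - y)

def IsTestFun (n : ℕ) (g : (Fin n → ℝ) → ℝ) : Prop :=
  ContDiff ℝ (⊤ : ℕ∞) g ∧ HasCompactSupport g

def phiOf (n : ℕ) (φ₀ : (Fin n → ℝ) → ℝ) (x : Fin n → ℝ) : ℝ :=
  φ₀ x - (2 : ℝ)⁻¹ ^ n * φ₀ ((2 : ℝ)⁻¹ • x)

def phiFam (n : ℕ) (φ₀ : (Fin n → ℝ) → ℝ) : ℕ → (Fin n → ℝ) → ℝ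
  | 0 => φ₀
  | k + 1 => fun x => (2 : ℝ) ^ ((k + 1) * n) * phiOf n φ₀ ((2 : ℝ) ^ (k + 1) • x)

def kernFam (n : ℕ) (ψ₀ ψ : (Fin n → ℝ) → ℝ) : ℕ → (Fin n → ℝ) → ℝ
  | 0 => ψ₀
  | k + 1 => fun x => (2 : ℝ) ^ ((k + 1) * n) * ψ ((2 : ℝ) ^ (k + 1) • x)

def besovNorm (n : ℕ) (p q : ℝ≥0∞) (t : ℕ → (Fin n → ℝ) → ℝ)
    (φ₀ : (Fin n → ℝ) → ℝ) (f : Dstrb n) : ℝ≥0∞ :=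
  lqNorm q fun k =>
    eLpNorm (fun x => t k x * distConv n f (phiFam n φ₀ k) x) p volume

def seSeminorm (n : ℕ) (N : ℕ) (g : (Fin n → ℝ) → ℝ) : ℝ≥0∞ :=
  ⨆ x : Fin n → ℝ, ENNReal.ofReal
    (Real.exp (N * ‖x‖) * ∑ i ∈ Finset.range (N + 1), ‖iteratedFDeriv ℝ i g x‖)

def MemSe' (n : ℕ) (f : Dstrb n) : Prop :=
  ∃ (C : ℝ) (N : ℕ), 0 < C ∧ ∀ g : (Fin n → ℝ) → ℝ, ContDiff ℝ (⊤ : ℕ∞) g →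
    ENNReal.ofReal |f g| ≤ ENNReal.ofReal C * seSeminorm n N g

def MomentsVanish (n : ℕ) (L : ℤ) (ψ : (Fin n → ℝ) → ℝ) : Prop :=
  ∀ β : Fin n → ℕ, ((∑ i, β i : ℕ) : ℤ) ≤ L → (∫ x, (∏ i, x i ^ β i) * ψ x) = 0

def sqNorm (d : ℕ) (y : Fin d → ℝ) : ℝ := Real.sqrt (∑ i, y i ^ 2)

def lowerPart (d : ℕ) (x : Fin (d + 1) → ℝ) : Fin d → ℝ := fun i => x i.castSucc

def IsLipFun (d : ℕ) (M : ℝ) (ϖ : (Fin d → ℝ) → ℝ) : Prop :=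
  ∀ y z, |ϖ y - ϖ z| ≤ M * sqNorm d (fun i => y i - z i)

def specialLip (d : ℕ) (ϖ : (Fin d → ℝ) → ℝ) : Set (Fin (d + 1) → ℝ) :=
  {x | ϖ (lowerPart d x) < x (Fin.last d)}

def negConeK (d : ℕ) (M : ℝ) : Set (Fin (d + 1) → ℝ) :=
  {x | M * sqNorm d (lowerPart d x) < -x (Fin.last d)}

def maxFunG (d : ℕ) (G : Set (Fin (d+1) → ℝ)) (φ₀ : (Fin (d+1) → ℝ) → ℝ) (A : ℝ)
    (m : Fin (d+1) → ℤ) (j : ℕ) (c : ℝ) (f : Dstrb (d+1)) : ℝ≥0∞ :=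
  ⨆ (k : ℕ) (_ : j ≤ k), ⨆ y ∈ dilatedCube (d+1) c j m ∩ G,
    ENNReal.ofReal ((2 : ℝ) ^ (A * ((j : ℝ) - (k : ℝ))) *
      |distConv (d+1) f (phiFam (d+1) φ₀ k) y|)

def MemSeG (n : ℕ) (G : Set (Fin n → ℝ)) (f : Dstrb n) : Prop :=
  ∃ (C : ℝ) (N : ℕ), 0 < C ∧ ∀ θ, IsTestFun n θ → tsupport θ ⊆ G →
    ENNReal.ofReal |f θ| ≤ ENNReal.ofReal C *
      ⨆ x ∈ G, ENNReal.ofReal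
        (Real.exp (N * ‖x‖) * ∑ i ∈ Finset.range (N + 1), ‖iteratedFDeriv ℝ i θ x‖)

def MemD' (n : ℕ) (U : Set (Fin n → ℝ)) (f : Dstrb n) : Prop :=
  ∀ K : Set (Fin n → ℝ), IsCompact K → K ⊆ U →
    ∃ (C : ℝ) (N : ℕ), 0 < C ∧ ∀ θ, IsTestFun n θ → tsupport θ ⊆ K →
      ENNReal.ofReal |f θ| ≤ ENNReal.ofReal C *
        ⨆ x, ENNReal.ofReal (∑ i ∈ Finset.range (N + 1), ‖iteratedFDeriv ℝ i θ x‖)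


/-! ### Convolution and distributions -/

section generic

set_option linter.unusedSectionVars false

variable {E : Type*} [NormedAddCommGroup E] [NormedSpace ℝ E] [FiniteDimensional ℝ E]
  [MeasureSpace E] [BorelSpace E] [(volume : Measure E).IsAddHaarMeasure]

def IsT (g : E → ℝ) : Prop := ContDiff ℝ (⊤ : ℕ∞) g ∧ HasCompactSupport g

def cv (g v : E → ℝ) (x : E) : ℝ := ∫ w, g w * v (x - w)

lemma fderiv_cv
    (h : E → ℝ) (hh : Continuous h) (q : E → ℝ) (hq : IsT q) (e : E) :
    (fun x => fderiv ℝ (cv h q) x e) = cv h (fun x => fderiv ℝ q x e) := by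
  ext x
  have h1 := hq.2.hasFDerivAt_convolution_right (μ := volume) (ContinuousLinearMap.mul ℝ ℝ)
    hh.locallyIntegrable (hq.1.of_le (by exact_mod_cast le_top)) x
  have h2 : fderiv ℝ (cv h q) x = _ := h1.fderiv
  rw [h2, convolution_precompR_apply]
  · rfl
  · exact hh.locallyIntegrable
  · exact hq.2.fderiv (𝕜 := ℝ)
  · exact hq.1.continuous_fderiv (by simp)

lemma testFun_fderiv {q : E → ℝ} (hq : IsT q) (e : E) : IsT (fun x => fderiv ℝ q x e) :=
  ⟨(hq.1.fderiv_right (m := (⊤ : ℕ∞)) (by exact_mod_cast le_top)).clm_apply contDiff_const,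
    hq.2.fderiv_apply (𝕜 := ℝ) e⟩

lemma testFun_cv {h q : E → ℝ} (hh : IsT h) (hq : IsT q) :
    IsT (cv h q) := by
  constructor
  · exact hq.2.contDiff_convolution_right (μ := volume) (ContinuousLinearMap.mul ℝ ℝ)
      hh.1.continuous.locallyIntegrable hq.1
  · exact HasCompactSupport.convolution (μ := volume) (ContinuousLinearMap.mul ℝ ℝ) hh.2 hq.2

lemma iteratedFDeriv_cv (h : E → ℝ) (hh : IsT h) (i : ℕ) : ∀ (q : E → ℝ)
    (_ : IsT q) (x : E) (m : Fin i → E),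
    iteratedFDeriv ℝ i (cv h q) x m = ∫ w, h w * iteratedFDeriv ℝ i q (x - w) m := by
  induction i with
  | zero =>
    intro q hq x m
    simp [cv]
  | succ i ih =>
    intro q hq x m
    have key : ∀ p : E → ℝ, IsT p → ∀ y, iteratedFDeriv ℝ (i + 1) p y m =
        iteratedFDeriv ℝ i (fun z => fderiv ℝ p z (m (Fin.last i))) y (Fin.init m) := by
      intro p hp y
      rw [iteratedFDeriv_succ_apply_right]
      rw [iteratedFDeriv_clm_apply_const_apply (n := (⊤ : ℕ∞))]
      · exact (hp.1.fderiv_right (m := (⊤ : ℕ∞)) (by exact_mod_cast le_top))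
      · exact_mod_cast le_top
    simp only [key _ hq, key _ (testFun_cv hh hq)]
    rw [fderiv_cv h hh.1.continuous q hq, ih _ (testFun_fderiv hq _)]

open scoped Pointwise in
lemma tsupport_cv {h q : E → ℝ} (hh : IsT h) (hq : IsT q) :
    tsupport (cv h q) ⊆ tsupport h + tsupport q := by
  apply closure_minimal
  · refine (support_convolution_subset (μ := volume) (ContinuousLinearMap.mul ℝ ℝ)).trans ?_
    exact Set.add_subset_add (subset_tsupport _) (subset_tsupport _)
  · exact (hh.2.isCompact.add hq.2.isCompact).isClosed

def bcf (η : E → ℝ) (hη : IsT η) (i : ℕ) :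
    BoundedContinuousFunction (E) (ContinuousMultilinearMap ℝ (fun _ : Fin i => E) ℝ) :=
  BoundedContinuousFunction.mkOfBound ⟨iteratedFDeriv ℝ i η, hη.1.continuous_iteratedFDeriv (by exact_mod_cast le_top)⟩
    (Classical.choose ((hη.2.iteratedFDeriv i).isCompact_range
      (hη.1.continuous_iteratedFDeriv (m := i) (by exact_mod_cast le_top))).isBounded.exists_norm_le +
     Classical.choose ((hη.2.iteratedFDeriv i).isCompact_range
      (hη.1.continuous_iteratedFDeriv (m := i) (by exact_mod_cast le_top))).isBounded.exists_norm_le) (by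
    intro x y
    have := Classical.choose_spec ((hη.2.iteratedFDeriv i).isCompact_range
      (hη.1.continuous_iteratedFDeriv (m := i) (by exact_mod_cast le_top))).isBounded.exists_norm_le
    exact (dist_le_norm_add_norm _ _).trans (add_le_add (this _ ⟨x, rfl⟩) (this _ ⟨y, rfl⟩)))

@[simp] lemma bcf_apply (η : E → ℝ) (hη : IsT η) (i : ℕ) (x : E) :
    bcf η hη i x = iteratedFDeriv ℝ i η x := rfl

def XX (E : Type*) [NormedAddCommGroup E] [NormedSpace ℝ E] (N : ℕ) := (i : Fin (N + 1)) →
    BoundedContinuousFunction (E) (ContinuousMultilinearMap ℝ (fun _ : Fin i => E) ℝ)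

instance (N : ℕ) : NormedAddCommGroup (XX E N) := Pi.normedAddCommGroup
instance (N : ℕ) : NormedSpace ℝ (XX E N) := Pi.normedSpace

instance (N : ℕ) : CompleteSpace (XX E N) :=
  inferInstanceAs (CompleteSpace ((i : Fin (N + 1)) →
    BoundedContinuousFunction (E) (ContinuousMultilinearMap ℝ (fun _ : Fin i => E) ℝ)))

def XX.proj (N : ℕ) (i : Fin (N + 1)) : XX E N →L[ℝ]
    BoundedContinuousFunction (E) (ContinuousMultilinearMap ℝ (fun _ : Fin i => E) ℝ) :=
  ContinuousLinearMap.proj (R := ℝ) (φ := fun i : Fin (N + 1) => BoundedContinuousFunction E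
        (ContinuousMultilinearMap ℝ (fun _ : Fin i => E) ℝ)) i

lemma XX.ext' {N : ℕ} {a b : XX E N} (h : ∀ i x, XX.proj N i a x = XX.proj N i b x) : a = b := by
  funext i
  ext1 x
  exact h i x

lemma XX.norm_proj (N : ℕ) (i : Fin (N + 1)) (a : XX E N) : ‖XX.proj N i a‖ ≤ ‖a‖ :=
  norm_le_pi_norm (ι := Fin (N + 1)) (G := fun i => BoundedContinuousFunction E
        (ContinuousMultilinearMap ℝ (fun _ : Fin i => E) ℝ)) a i

def xbcf (N : ℕ) (η : E → ℝ) (hη : IsT η) : XX E N := fun i => bcf η hη i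

@[simp] lemma xbcf_proj (N : ℕ) (η : E → ℝ) (hη : IsT η) (i : Fin (N + 1)) (x : E) :
    XX.proj N i (xbcf N η hη) x = iteratedFDeriv ℝ i η x := rfl

lemma XX.continuous {Z : Type*} [TopologicalSpace Z] {N : ℕ} {g : Z → XX E N}
    (h : ∀ i, Continuous fun z => XX.proj N i (g z)) : Continuous g :=
  continuous_pi (A := fun i : Fin (N + 1) => BoundedContinuousFunction E
        (ContinuousMultilinearMap ℝ (fun _ : Fin i => E) ℝ)) h

def TestK (K : Set (E)) : Submodule ℝ (E → ℝ) where
  carrier := {θ | IsT θ ∧ tsupport θ ⊆ K}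
  add_mem' := by
    rintro a b ⟨ha, ha'⟩ ⟨hb, hb'⟩
    exact ⟨⟨ha.1.add hb.1, ha.2.add hb.2⟩, (tsupport_add a b).trans (Set.union_subset ha' hb')⟩
  zero_mem' := ⟨⟨contDiff_const, HasCompactSupport.zero⟩, by simp [tsupport]⟩
  smul_mem' := by
    rintro c a ⟨ha, ha'⟩
    exact ⟨⟨ha.1.const_smul c, ha.2.smul_left (f := fun _ => c)⟩,
      (tsupport_smul_subset_right (fun _ => c) a).trans ha'⟩

def JJ (N : ℕ) (K : Set (E)) : TestK K →ₗ[ℝ] XX E N where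
  toFun θ := xbcf N θ.1 θ.2.1
  map_add' := by
    intro a b
    apply XX.ext'
    intro i x
    simp only [map_add, xbcf_proj, BoundedContinuousFunction.add_apply, Submodule.coe_add]
    rw [iteratedFDeriv_add_apply]
    · exact (a.2.1.1.of_le (by exact_mod_cast le_top)).contDiffAt
    · exact (b.2.1.1.of_le (by exact_mod_cast le_top)).contDiffAt
  map_smul' := by
    intro c a
    apply XX.ext'
    intro i x
    simp only [map_smul, xbcf_proj, BoundedContinuousFunction.smul_apply, Submodule.coe_smul,
      RingHom.id_apply]
    rw [iteratedFDeriv_const_smul_apply]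
    exact (a.2.1.1.of_le (by exact_mod_cast le_top)).contDiffAt

lemma JJ_inj (N : ℕ) (K : Set (E)) : Function.Injective (JJ N K) := by
  intro a b hab
  ext x
  have h2 : iteratedFDeriv ℝ 0 a.1 x (fun _ => 0) = iteratedFDeriv ℝ 0 b.1 x (fun _ => 0) :=
    congrArg (fun q : XX E N => XX.proj N 0 q x (fun _ => 0)) hab
  simpa using h2

def MemG (U : Set E) (f : (E → ℝ) →ₗ[ℝ] ℝ) : Prop :=
  ∀ K : Set E, IsCompact K → K ⊆ U →
    ∃ (C : ℝ) (N : ℕ), 0 < C ∧ ∀ θ, IsT θ → tsupport θ ⊆ K →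
      ENNReal.ofReal |f θ| ≤ ENNReal.ofReal C *
        ⨆ x, ENNReal.ofReal (∑ i ∈ Finset.range (N + 1), ‖iteratedFDeriv ℝ i θ x‖)

lemma dist_extend {U : Set (E)} {f : (E → ℝ) →ₗ[ℝ] ℝ} (hf : MemG U f) {K : Set (E)}
    (hK : IsCompact K) (hKU : K ⊆ U) :
    ∃ (N : ℕ) (F : XX E N →L[ℝ] ℝ), ∀ (θ : E → ℝ) (hθ : IsT θ), tsupport θ ⊆ K →
      f θ = F (xbcf N θ hθ) := by
  obtain ⟨C, N, hC, hb⟩ := hf K hK hKU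
  have key : ∀ θ : TestK K, |f θ.1| ≤ C * (N + 1) * ‖JJ N K θ‖ := by
    intro θ
    have h1 := hb θ.1 θ.2.1 θ.2.2
    have h2 : (⨆ x, ENNReal.ofReal (∑ i ∈ Finset.range (N + 1), ‖iteratedFDeriv ℝ i θ.1 x‖)) ≤
        ENNReal.ofReal ((N + 1) * ‖JJ N K θ‖) := by
      apply iSup_le
      intro x
      apply ENNReal.ofReal_le_ofReal
      calc _ ≤ ∑ i ∈ Finset.range (N + 1), ‖JJ N K θ‖ := by
            apply Finset.sum_le_sum
            intro i hi
            have e1 := (XX.proj N ⟨i, Finset.mem_range.1 hi⟩ (JJ N K θ)).norm_coe_le_norm x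
            have e2 := XX.norm_proj N ⟨i, Finset.mem_range.1 hi⟩ (JJ N K θ)
            exact le_trans e1 e2
        _ = _ := by simp
    have h3 := h1.trans (mul_le_mul_right h2 _)
    rw [← ENNReal.ofReal_mul hC.le, ENNReal.ofReal_le_ofReal_iff (by positivity)] at h3
    linarith
  let e := LinearEquiv.ofInjective (JJ N K) (JJ_inj N K)
  let f1 : LinearMap.range (JJ N K) →ₗ[ℝ] ℝ := (f.comp (TestK K).subtype).comp e.symm.toLinearMap
  have hf1 : ∀ p, ‖f1 p‖ ≤ C * (N + 1) * ‖p‖ := by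
    intro p
    obtain ⟨θ, rfl⟩ := e.surjective p
    have h1 : f1 (e θ) = f θ.1 := by
      change f (e.symm (e θ)).1 = _
      rw [e.symm_apply_apply]
    rw [h1]
    exact key θ
  obtain ⟨F, hF, -⟩ := exists_extension_norm_eq _ (f1.mkContinuous _ hf1)
  refine ⟨N, F, fun θ hθ hs => ?_⟩
  have := hF (e ⟨θ, hθ, hs⟩)
  have h1 : f1 (e ⟨θ, hθ, hs⟩) = f θ := by
    change f (e.symm (e _)).1 = _
    rw [e.symm_apply_apply]
  exact h1.symm.trans this.symm

lemma testFun_translate {η : E → ℝ} (hη : IsT η) (w : E) :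
    IsT (fun z => η (z - w)) :=
  ⟨hη.1.comp (by fun_prop), hη.2.comp_homeomorph (Homeomorph.subRight w)⟩

lemma continuous_bcf_translate {η : E → ℝ} (hη : IsT η) (i : ℕ) :
    Continuous fun w => bcf _ (testFun_translate hη w) i := by
  have huc : UniformContinuous (iteratedFDeriv ℝ i η) :=
    (hη.1.continuous_iteratedFDeriv (by exact_mod_cast le_top)).uniformContinuous_of_tendsto_cocompact
      ((hη.2.iteratedFDeriv i).is_zero_at_infty)
  rw [Metric.continuous_iff]
  intro w ε hε
  obtain ⟨δ, hδ, h⟩ := Metric.uniformContinuous_iff.1 huc (ε / 2) (by positivity)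
  refine ⟨δ, hδ, fun a ha => ?_⟩
  refine lt_of_le_of_lt ((BoundedContinuousFunction.dist_le (by positivity : 0 ≤ ε / 2)).2 ?_)
    (half_lt_self hε)
  intro x
  simp only [bcf_apply, iteratedFDeriv_comp_sub]
  apply (h _).le
  rw [dist_sub_left]
  exact ha

/-- The package: near a compact set a distribution is given by a functional commuting with
convolutions. -/
lemma dist_package {U : Set (E)} {f : (E → ℝ) →ₗ[ℝ] ℝ} (hf : MemG U f) {K : Set (E)}
    (hK : IsCompact K) (hKU : K ⊆ U) :
    ∃ Fl : (E → ℝ) → ℝ,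
      (∀ θ : E → ℝ, IsT θ → tsupport θ ⊆ K → f θ = Fl θ) ∧
      (∀ η, IsT η → Continuous fun w => Fl (fun z => η (z - w))) ∧
      (∀ h η, IsT h → IsT η →
        Fl (cv h η) = ∫ w, h w * Fl (fun z => η (z - w))) := by
  classical
  obtain ⟨N, F, hF⟩ := dist_extend hf hK hKU
  refine ⟨fun θ => if h : IsT θ then F (xbcf N θ h) else 0, ?_, ?_, ?_⟩
  · intro θ hθ hs
    simp only [dif_pos hθ]
    exact hF θ hθ hs
  · intro η hη
    simp only [dif_pos (testFun_translate hη _)]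
    exact F.continuous.comp (XX.continuous fun i => continuous_bcf_translate hη i)
  · intro h η hh hη
    simp only [dif_pos (testFun_translate hη _), dif_pos (testFun_cv hh hη)]
    have hc : Continuous fun w => xbcf N _ (testFun_translate hη w) :=
      XX.continuous fun i => continuous_bcf_translate hη i
    have hint : Integrable fun w =>
        h w • xbcf N _ (testFun_translate hη w) :=
      (hh.1.continuous.smul hc).integrable_of_hasCompactSupport (hh.2.smul_right)
    have e1 := F.integral_comp_comm hint
    simp only [map_smul, smul_eq_mul] at e1
    rw [e1]
    congr 1
    apply XX.ext'
    intro i x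
    rw [xbcf_proj]
    ext m
    rw [iteratedFDeriv_cv h hh i η hη]
    have e2 := ((ContinuousMultilinearMap.apply ℝ (fun _ : Fin i => E) ℝ m).comp
      ((BoundedContinuousFunction.evalCLM ℝ x).comp (XX.proj N i))).integral_comp_comm hint
    refine Eq.trans ?_ e2
    congr 1
    ext1 w
    simp only [map_smul, smul_eq_mul]
    congr 1
    change _ = iteratedFDeriv ℝ i _ x m
    rw [iteratedFDeriv_comp_sub]

end generic

section generic2

set_option linter.unusedSectionVars false

variable {E : Type*} [NormedAddCommGroup E] [NormedSpace ℝ E] [FiniteDimensional ℝ E]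
  [MeasureSpace E] [BorelSpace E] [(volume : Measure E).IsAddHaarMeasure]

lemma integrable_cv {g v : E → ℝ} (hg : IsT g) (hv : Continuous v) (x : E) :
    Integrable (fun w => g w * v (x - w)) :=
  (hg.1.continuous.mul (hv.comp (by fun_prop))).integrable_of_hasCompactSupport hg.2.mul_right

lemma continuous_cv {g v : E → ℝ} (hg : IsT g) (hv : Continuous v) : Continuous (cv g v) :=
  hg.2.continuous_convolution_left (μ := volume) (ContinuousLinearMap.mul ℝ ℝ) hg.1.continuous
    hv.locallyIntegrable

lemma cv_comm (g v : E → ℝ) : cv g v = cv v g := by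
  ext x
  unfold cv
  rw [← integral_sub_left_eq_self _ volume x]
  simp [mul_comm]

lemma cv_assoc {g h v : E → ℝ} (hg : IsT g) (hh : IsT h) (hv : Continuous v) :
    cv g (cv h v) = cv (cv g h) v := by
  ext x
  have hgc := hg.1.continuous
  have hhc := hh.1.continuous
  refine (convolution_assoc (μ := volume) (ν := volume) (ContinuousLinearMap.mul ℝ ℝ)
    (ContinuousLinearMap.mul ℝ ℝ) (ContinuousLinearMap.mul ℝ ℝ) (ContinuousLinearMap.mul ℝ ℝ)
    (f := g) (g := h) (k := v) ?_ hgc.aestronglyMeasurable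
    hhc.aestronglyMeasurable hv.aestronglyMeasurable ?_ ?_ ?_).symm
  · intro x y z; simp [mul_assoc]
  · exact Eventually.of_forall fun y => hg.2.convolutionExists_left _ hgc hhc.locallyIntegrable y
  · exact Eventually.of_forall fun y => hh.2.norm.convolutionExists_left _ hhc.norm
      hv.norm.locallyIntegrable y
  · exact hg.2.norm.convolutionExists_left _ hgc.norm
      (hh.2.norm.continuous_convolution_left (μ := volume) (ContinuousLinearMap.mul ℝ ℝ) hhc.norm
        hv.norm.locallyIntegrable).locallyIntegrable x

/-- The operator `T` is convolution with `g`. -/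
def IsConv (T : Module.End ℝ C(E, ℝ)) (g : E → ℝ) : Prop := ∀ v : C(E, ℝ), ⇑(T v) = cv g v

def cvEnd (g : E → ℝ) (hg : IsT g) : Module.End ℝ C(E, ℝ) where
  toFun v := ⟨cv g v, continuous_cv hg v.continuous⟩
  map_add' a b := by
    ext x
    simp only [cv, ContinuousMap.coe_mk, ContinuousMap.add_apply, mul_add]
    exact integral_add (integrable_cv hg a.continuous x) (integrable_cv hg b.continuous x)
  map_smul' c a := by
    ext x
    simp only [cv, ContinuousMap.coe_mk, ContinuousMap.smul_apply, smul_eq_mul, RingHom.id_apply]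
    rw [← integral_const_mul]
    congr 1
    ext w
    ring

lemma isConv_cvEnd (g : E → ℝ) (hg : IsT g) : IsConv (cvEnd g hg) g := fun _ => rfl

def inN (C : Set E) (T : Module.End ℝ C(E, ℝ)) : Prop :=
  ∃ g : E → ℝ, IsT g ∧ tsupport g ⊆ C ∧ IsConv T g

lemma inN.zero (C : Set E) : inN C (0 : Module.End ℝ C(E, ℝ)) := by
  refine ⟨0, ⟨contDiff_const, HasCompactSupport.zero⟩, by simp [tsupport], ?_⟩
  intro v
  ext x
  simp [cv]

lemma inN.add {C : Set E} {S T : Module.End ℝ C(E, ℝ)} (hS : inN C S) (hT : inN C T) :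
    inN C (S + T) := by
  obtain ⟨g, hg, hgC, hS⟩ := hS
  obtain ⟨h, hh, hhC, hT⟩ := hT
  refine ⟨g + h, ⟨hg.1.add hh.1, hg.2.add hh.2⟩,
    (tsupport_add g h).trans (Set.union_subset hgC hhC), ?_⟩
  intro v
  ext x
  simp only [LinearMap.add_apply, ContinuousMap.add_apply, hS v, hT v, cv, Pi.add_apply, add_mul]
  exact (integral_add (integrable_cv hg v.continuous x) (integrable_cv hh v.continuous x)).symm

lemma IsConv.smul {T : Module.End ℝ C(E, ℝ)} {g : E → ℝ} (hT : IsConv T g) (c : ℝ) :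
    IsConv (c • T) (fun x => c * g x) := by
  intro v
  ext x
  simp only [LinearMap.smul_apply, ContinuousMap.smul_apply, hT v, cv, smul_eq_mul]
  rw [← integral_const_mul]
  congr 1
  ext w
  ring

lemma IsT.const_mul {g : E → ℝ} (hg : IsT g) (c : ℝ) : IsT (fun x => c * g x) :=
  ⟨contDiff_const.mul hg.1, hg.2.mul_left⟩

lemma tsupport_const_mul {g : E → ℝ} (c : ℝ) : tsupport (fun x => c * g x) ⊆ tsupport g :=
  tsupport_mul_subset_right

lemma inN.smul {C : Set E} {T : Module.End ℝ C(E, ℝ)} (hT : inN C T) (c : ℝ) :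
    inN C (c • T) := by
  obtain ⟨g, hg, hgC, hT⟩ := hT
  exact ⟨_, hg.const_mul c, (tsupport_const_mul c).trans hgC, hT.smul c⟩

lemma inN.sub {C : Set E} {S T : Module.End ℝ C(E, ℝ)} (hS : inN C S) (hT : inN C T) :
    inN C (S - T) := by
  have h0 : S - T = S + (-1 : ℝ) • T := by
    ext v x
    simp only [LinearMap.sub_apply, LinearMap.add_apply, LinearMap.smul_apply,
      ContinuousMap.sub_apply, ContinuousMap.add_apply, ContinuousMap.smul_apply, smul_eq_mul]
    ring
  rw [h0]
  exact hS.add (hT.smul (-1))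

lemma IsConv.mul {S T : Module.End ℝ C(E, ℝ)} {g h : E → ℝ} (hg : IsT g) (hh : IsT h)
    (hS : IsConv S g) (hT : IsConv T h) : IsConv (S * T) (cv g h) := by
  intro v
  rw [Module.End.mul_apply, hS, hT, cv_assoc hg hh v.continuous]

lemma IsConv.commute {S T : Module.End ℝ C(E, ℝ)} {g h : E → ℝ} (hg : IsT g) (hh : IsT h)
    (hS : IsConv S g) (hT : IsConv T h) : Commute S T := by
  refine LinearMap.ext fun v => DFunLike.coe_injective ?_
  rw [IsConv.mul hg hh hS hT, IsConv.mul hh hg hT hS, cv_comm g h]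

lemma inN.mul {C : Set E} (hC : ∀ x ∈ C, ∀ y ∈ C, x + y ∈ C) {S T : Module.End ℝ C(E, ℝ)}
    (hS : inN C S) (hT : inN C T) : inN C (S * T) := by
  obtain ⟨g, hg, hgC, hS⟩ := hS
  obtain ⟨h, hh, hhC, hT⟩ := hT
  refine ⟨cv g h, testFun_cv hg hh, (tsupport_cv hg hh).trans ?_, IsConv.mul hg hh hS hT⟩
  rintro _ ⟨x, hx, y, hy, rfl⟩
  exact hC x (hgC hx) y (hhC hy)

lemma inN.one_sub_pow_mul {C : Set E} (hC : ∀ x ∈ C, ∀ y ∈ C, x + y ∈ C)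
    {a T : Module.End ℝ C(E, ℝ)} (ha : inN C a) (hT : inN C T) (i : ℕ) :
    inN C ((1 - a) ^ i * T) := by
  induction i with
  | zero => simpa using hT
  | succ i ih =>
    rw [pow_succ', mul_assoc, sub_mul, one_mul]
    exact ih.sub (ha.mul hC ih)

/-- Dilation operators. -/
def dl (c : ℝ) : Module.End ℝ C(E, ℝ) where
  toFun v := ⟨fun x => v (c • x), by fun_prop⟩
  map_add' a b := by ext x; simp
  map_smul' c a := by ext x; simp

lemma dl_mul (c c' : ℝ) : (dl c * dl c' : Module.End ℝ C(E, ℝ)) = dl (c * c') := by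
  ext v x
  simp [dl, smul_smul, mul_comm]

lemma dl_one : (dl 1 : Module.End ℝ C(E, ℝ)) = 1 := by
  ext v x
  simp [dl]

def scl (c : ℝ) (g : E → ℝ) (x : E) : ℝ := c ^ (Module.finrank ℝ E) * g (c • x)

lemma IsT.scl {g : E → ℝ} (hg : IsT g) {c : ℝ} (hc : 0 < c) : IsT (scl c g) :=
  IsT.const_mul (g := fun x => g (c • x)) ⟨hg.1.comp (by fun_prop),
    hg.2.comp_homeomorph (Homeomorph.smulOfNeZero c hc.ne')⟩ _

lemma tsupport_scl {g : E → ℝ} {c : ℝ} : ∀ x ∈ tsupport (scl c g), c • x ∈ tsupport g := by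
  intro x hx
  have : tsupport (scl c g) ⊆ (fun x => c • x) ⁻¹' tsupport g := by
    apply closure_minimal
    · intro y hy
      apply subset_tsupport
      intro h0
      apply hy
      simp [scl, h0]
    · exact (isClosed_tsupport g).preimage (by fun_prop)
  exact this hx

lemma integral_scl {c : ℝ} (hc : 0 < c) (g : E → ℝ) (F : E → ℝ) :
    ∫ w, scl c g w * F w = ∫ w, g w * F (c⁻¹ • w) := by
  have h1 := Measure.integral_comp_smul (volume : Measure E) (fun w => g w * F (c⁻¹ • w)) c
  have h2 : ∀ w, scl c g w * F w = c ^ (Module.finrank ℝ E) * (g (c • w) * F (c⁻¹ • c • w)) := by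
    intro w
    rw [inv_smul_smul₀ hc.ne', scl]
    ring
  simp only [h2]
  rw [integral_const_mul, h1, abs_of_pos (by positivity), smul_eq_mul,
    mul_inv_cancel_left₀ (by positivity)]

lemma IsConv.scl {T : Module.End ℝ C(E, ℝ)} {g : E → ℝ} (hT : IsConv T g) {c : ℝ} (hc : 0 < c) :
    IsConv (dl c * T * dl c⁻¹) (scl c g) := by
  intro v
  ext x
  have h1 : ((dl c * T * dl c⁻¹ : Module.End ℝ C(E, ℝ)) v) x = (T (dl c⁻¹ v)) (c • x) := rfl
  rw [h1, hT]
  unfold cv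
  rw [integral_scl hc g (fun w => v (x - w))]
  congr 1
  ext w
  congr 1
  change v (c⁻¹ • (c • x - w)) = _
  rw [smul_sub, inv_smul_smul₀ hc.ne']

/-- Polynomials of degree `< j` described by finite differences. -/
def WW : ℕ → (E → ℝ) → Prop
  | 0, v => v = 0
  | j + 1, v => ∀ h : E, WW j (fun x => v (x - h) - v x)

lemma WW.zero (j : ℕ) : WW j (0 : E → ℝ) := by
  induction j with
  | zero => rfl
  | succ j ih =>
    intro h
    convert ih using 1
    ext x
    simp

lemma WW.add {j : ℕ} : ∀ {u v : E → ℝ}, WW j u → WW j v → WW j (fun x => u x + v x) := by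
  induction j with
  | zero =>
    rintro u v rfl rfl
    ext x
    simp
  | succ j ih =>
    intro u v hu hv h
    convert ih (hu h) (hv h) using 1
    ext x
    ring

lemma WW.smul {j : ℕ} (c : ℝ) : ∀ {u : E → ℝ}, WW j u → WW j (fun x => c * u x) := by
  induction j with
  | zero =>
    rintro u rfl
    ext x
    simp
  | succ j ih =>
    intro u hu h
    convert ih (hu h) using 1
    ext x
    ring

lemma WW.succ {j : ℕ} : ∀ {u : E → ℝ}, WW j u → WW (j + 1) u := by
  induction j with
  | zero =>
    rintro u rfl
    exact WW.zero 1
  | succ j ih =>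
    intro u hu h
    exact ih (hu h)

lemma WW.mul_linear (l : E →ₗ[ℝ] ℝ) {j : ℕ} :
    ∀ {u : E → ℝ}, WW j u → WW (j + 1) (fun x => l x * u x) := by
  induction j with
  | zero =>
    rintro u rfl
    convert (WW.zero 1 : WW 1 (0 : E → ℝ)) using 1
    ext x
    simp
  | succ j ih =>
    intro u hu h
    have h1 := ih (hu h)
    have h2 : WW (j + 1) (fun x => -l h * ((u (x - h) - u x) + u x)) :=
      (((hu h).succ).add hu).smul _
    convert h1.add h2 using 1
    ext x
    simp only [map_sub]
    ring

lemma WW.one_sub_conv {g : E → ℝ} (hg : IsT g) (hi : ∫ x, g x = 1) {j : ℕ} :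
    ∀ {v : E → ℝ}, Continuous v → WW (j + 1) v → WW j (fun x => v x - cv g v x) := by
  induction j with
  | zero =>
    intro v hv hW
    have h0 : ∀ y, v y = v 0 := by
      intro y
      have := congrFun (hW (-y)) 0
      simp at this
      linarith
    ext x
    simp only [cv, h0, integral_mul_const, hi]
    simp
  | succ j ih =>
    intro v hv hW h
    have h1 := ih (v := fun x => v (x - h) - v x) (by fun_prop) (hW h)
    convert h1 using 1
    ext x
    have : cv g (fun x => v (x - h) - v x) x = cv g v (x - h) - cv g v x := by
      unfold cv
      rw [← integral_sub (integrable_cv hg hv _) (integrable_cv hg hv _)]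
      congr 1
      ext w
      rw [mul_sub]
      congr 3
      abel
    rw [this]
    ring

lemma WW.one_sub_pow {a : Module.End ℝ C(E, ℝ)} {g : E → ℝ} (hg : IsT g) (hi : ∫ x, g x = 1)
    (ha : IsConv a g) (i : ℕ) : ∀ (j : ℕ) (v : C(E, ℝ)), WW (j + i) v → WW j ((1 - a) ^ i • v) := by
  induction i with
  | zero => intro j v h; simpa using h
  | succ i ih =>
    intro j v h
    rw [pow_succ', mul_smul]
    have h1 := WW.one_sub_conv hg hi (map_continuous _) (ih (j + 1) v (by convert h using 1; ring))
    convert h1 using 1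
    rw [← ha]
    rfl

lemma op_exists {C : Set E} (hC : ∀ x ∈ C, ∀ y ∈ C, x + y ∈ C)
    {a b : Module.End ℝ C(E, ℝ)} {g g' : E → ℝ}
    (hg : IsT g) (hgC : tsupport g ⊆ C) (hgi : ∫ x, g x = 1) (ha : IsConv a g)
    (hg' : IsT g') (hgC' : tsupport g' ⊆ C) (hgi' : ∫ x, g' x = 1) (hb : IsConv b g')
    (hab : b = dl 2⁻¹ * a * dl 2) (m : ℕ) :
    ∃ A P0 P : Module.End ℝ C(E, ℝ), inN C A ∧ inN C P0 ∧ inN C P ∧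
      a * P0 = A ∧ (a - b) * P = A - dl 2⁻¹ * A * dl 2 ∧
      (∀ v : C(E, ℝ), WW (m + 1) v → A v = v) ∧ (∀ v : C(E, ℝ), WW (m + 1) v → P v = 0) := by
  have hcab : Commute a b := IsConv.commute hg hg' ha hb
  have haN : inN C a := ⟨g, hg, hgC, ha⟩
  have hbN : inN C b := ⟨g', hg', hgC', hb⟩
  have hsum : ∀ {T : ℕ → Module.End ℝ C(E, ℝ)} (k : ℕ), (∀ i, inN C (T i)) →
      inN C (∑ i ∈ Finset.range k, T i) := by
    intro T k h
    exact Finset.sum_induction _ (inN C) (fun _ _ h1 h2 => h1.add h2) (inN.zero C) fun i _ => h i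
  have hgeo : ∀ x : Module.End ℝ C(E, ℝ), 1 - (1 - x) ^ (m + 2) =
      ∑ i ∈ Finset.range (m + 2), (1 - x) ^ i * x := by
    intro x
    have := geom_sum_mul_neg (1 - x) (m + 2)
    have h0 : 1 - (1 - x) = x := by abel
    rw [h0, Finset.sum_mul] at this
    exact this.symm
  set e := 1 - a with he
  set e' := 1 - b with he'
  set u := 1 - e ^ (m + 2) with hu
  set u' := 1 - e' ^ (m + 2) with hu'
  have huN : inN C u := by
    rw [hu, he, hgeo]
    exact hsum _ fun i => haN.one_sub_pow_mul hC haN i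
  have huN' : inN C u' := by
    rw [hu', he', hgeo]
    exact hsum _ fun i => hbN.one_sub_pow_mul hC hbN i
  have c1 : Commute e e' := by
    rw [he, he']
    exact ((Commute.one_left _).sub_left ((Commute.one_right _).sub_right hcab))
  have cuu : Commute u u' := by
    rw [hu, hu']
    exact (Commute.one_left _).sub_left ((Commute.one_right _).sub_right (c1.pow_pow _ _))
  have cau : Commute a e := by
    rw [he]
    exact (Commute.one_right _).sub_right (Commute.refl a)
  have hD : (dl 2 * dl 2⁻¹ : Module.End ℝ C(E, ℝ)) = 1 := by
    rw [dl_mul, mul_inv_cancel₀ two_ne_zero, dl_one]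
  have hD' : (dl 2⁻¹ * dl 2 : Module.End ℝ C(E, ℝ)) = 1 := by
    rw [dl_mul, inv_mul_cancel₀ two_ne_zero, dl_one]
  have hpow : ∀ (x : Module.End ℝ C(E, ℝ)) (k : ℕ), (dl 2⁻¹ * x * dl 2) ^ k = dl 2⁻¹ * x ^ k * dl 2 := by
    intro x k
    induction k with
    | zero => simp [hD']
    | succ k ih =>
      rw [pow_succ, ih, pow_succ]
      calc dl 2⁻¹ * x ^ k * dl 2 * (dl 2⁻¹ * x * dl 2)
          = dl 2⁻¹ * x ^ k * (dl 2 * dl 2⁻¹) * x * dl 2 := by noncomm_ring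
        _ = _ := by rw [hD]; noncomm_ring
  have hue : u' = dl 2⁻¹ * u * dl 2 := by
    have h1 : e' = dl 2⁻¹ * e * dl 2 := by
      rw [he', he, hab, mul_sub, sub_mul, mul_one, hD']
    rw [hu', hu, h1, hpow, mul_sub, sub_mul, mul_one, hD']
  have hu1 : ∀ v : C(E, ℝ), WW (m + 1) v → u v = v := by
    intro v hv
    have h1 := WW.one_sub_pow hg hgi ha (m + 2) 0 v (by convert hv.succ using 1; ring)
    have h2 : e ^ (m + 2) • v = 0 := DFunLike.coe_injective h1
    rw [hu, LinearMap.sub_apply]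
    change v - e ^ (m + 2) • v = v
    rw [h2, sub_zero]
  have hu1' : ∀ v : C(E, ℝ), WW (m + 1) v → u' v = v := by
    intro v hv
    have h1 := WW.one_sub_pow hg' hgi' hb (m + 2) 0 v (by convert hv.succ using 1; ring)
    have h2 : e' ^ (m + 2) • v = 0 := DFunLike.coe_injective h1
    rw [hu', LinearMap.sub_apply]
    change v - e' ^ (m + 2) • v = v
    rw [h2, sub_zero]
  refine ⟨u * u, ∑ i ∈ Finset.range (m + 2), e ^ i * u,
    ∑ i ∈ Finset.range (m + 2), e' ^ i * (e ^ (m + 1 - i) * (u + u')),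
    huN.mul hC huN, hsum _ fun i => haN.one_sub_pow_mul hC huN i,
    hsum _ fun i => hbN.one_sub_pow_mul hC (haN.one_sub_pow_mul hC (huN.add huN') _) _,
    ?_, ?_, ?_, ?_⟩
  · rw [← Finset.sum_mul, ← mul_assoc]
    congr 1
    rw [hu, he, hgeo, Finset.mul_sum]
    refine Finset.sum_congr rfl fun i _ => ?_
    exact (cau.pow_right i).eq
  · have h1 := c1.symm.mul_geom_sum₂ (m + 2)
    have h2 : e' - e = a - b := by rw [he, he']; abel
    have h3 : e' ^ (m + 2) - e ^ (m + 2) = u - u' := by rw [hu, hu']; abel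
    simp only [← mul_assoc]
    rw [← Finset.sum_mul, ← mul_assoc, ← h2]
    have h4 : (e' - e) * ∑ i ∈ Finset.range (m + 2), e' ^ i * e ^ (m + 1 - i) = u - u' := by
      rw [← h3, ← h1]
      rfl
    rw [h4]
    have h5 : dl 2⁻¹ * u * u * dl 2 = u' * u' := by
      rw [hue]
      calc dl 2⁻¹ * u * u * dl 2 = dl 2⁻¹ * u * 1 * u * dl 2 := by noncomm_ring
        _ = _ := by rw [← hD]; noncomm_ring
    rw [h5, sub_mul, mul_add, mul_add, cuu.eq]
    abel
  · intro v hv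
    rw [Module.End.mul_apply, hu1 v hv, hu1 v hv]
  · intro v hv
    rw [LinearMap.sum_apply]
    refine Finset.sum_eq_zero fun i hi => ?_
    have hi' : i < m + 2 := Finset.mem_range.1 hi
    have h2 : WW (m + 1) ⇑((u + u') v) := by
      rw [LinearMap.add_apply, hu1 v hv, hu1' v hv]
      exact hv.add hv
    have h3 := WW.one_sub_pow hg hgi ha (m + 1 - i) i ((u + u') v) (by
      rw [show i + (m + 1 - i) = m + 1 by omega]; exact h2)
    have h4 := WW.one_sub_pow hg' hgi' hb i 0 (e ^ (m + 1 - i) • ((u + u') v)) (by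
      rw [zero_add]; exact h3)
    exact DFunLike.coe_injective h4

end generic2

section generic3

set_option linter.unusedSectionVars false

variable {E : Type*} [NormedAddCommGroup E] [NormedSpace ℝ E] [FiniteDimensional ℝ E]
  [MeasureSpace E] [BorelSpace E] [(volume : Measure E).IsAddHaarMeasure]

lemma tsupport_translate {p : E → ℝ} (y : E) :
    ∀ z ∈ tsupport (fun z => p (z - y)), z - y ∈ tsupport p := by
  intro z hz
  have : tsupport (fun z => p (z - y)) ⊆ (fun z => z - y) ⁻¹' tsupport p := by
    apply closure_minimal
    · intro w hw
      exact subset_tsupport _ hw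
    · exact (isClosed_tsupport p).preimage (by fun_prop)
  exact this hz

open scoped Pointwise in
lemma term_eq {C G : Set E} (hGC : ∀ x ∈ G, ∀ c ∈ C, x + c ∈ G)
    {kp p θ : E → ℝ} (hk : IsT kp) (hp : IsT p) (hθ : IsT θ)
    (hkC : tsupport kp ⊆ C) (hpC : tsupport p ⊆ C) (hθG : tsupport θ ⊆ G)
    {f : (E → ℝ) →ₗ[ℝ] ℝ} (hf : MemG G f) :
    ∫ x, (∫ y, kp (y - x) * f (fun z => p (z - y))) * θ x = f (cv p (cv kp θ)) := by
  have hKG : tsupport p + (tsupport kp + tsupport θ) ⊆ G := by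
    rintro _ ⟨c, hc, _, ⟨k, hk, t, ht, rfl⟩, rfl⟩
    have := hGC _ (hGC t (hθG ht) k (hkC hk)) c (hpC hc)
    convert this using 1
    dsimp only
    abel
  obtain ⟨Fl, h1, h2, h3⟩ := dist_package hf
    (hp.2.isCompact.add (hk.2.isCompact.add hθ.2.isCompact)) hKG
  have e1 : ∀ x, (∫ y, kp (y - x) * f (fun z => p (z - y))) * θ x =
      ∫ y, θ x * kp (y - x) * Fl (fun z => p (z - y)) := by
    intro x
    rw [← integral_mul_const]
    congr 1
    ext y
    by_cases hx : θ x = 0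
    · simp [hx]
    by_cases hy : kp (y - x) = 0
    · simp [hy]
    rw [h1 _ (testFun_translate hp y)]
    · ring
    · intro z hz
      refine ⟨z - y, tsupport_translate y z hz, y, ⟨y - x, subset_tsupport _ hy, x,
        subset_tsupport _ hx, by simp⟩, by simp⟩
  simp only [e1]
  have hkc := hk.1.continuous
  have hθc := hθ.1.continuous
  have hFc := h2 p hp
  rw [integral_integral_swap_of_hasCompactSupport]
  · have e2 : ∀ y, ∫ x, θ x * kp (y - x) * Fl (fun z => p (z - y)) =
        cv kp θ y * Fl (fun z => p (z - y)) := by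
      intro y
      rw [integral_mul_const, cv_comm]
      rfl
    simp only [e2]
    rw [← h3 _ _ (testFun_cv hk hθ) hp, cv_comm, h1 _ (testFun_cv hp (testFun_cv hk hθ))]
    exact (tsupport_cv hp (testFun_cv hk hθ)).trans
      (Set.add_subset_add_left (tsupport_cv hk hθ))
  · have : Continuous fun q : E × E => Fl (fun z => p (z - q.2)) := hFc.comp continuous_snd
    exact ((hθc.comp continuous_fst).mul (hkc.comp (by fun_prop))).mul this
  · refine HasCompactSupport.intro (hθ.2.isCompact.prod (hk.2.isCompact.add hθ.2.isCompact)) ?_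
    rintro ⟨x, y⟩ hxy
    simp only [Function.uncurry_apply_pair]
    by_cases hx : θ x = 0
    · simp [hx]
    by_cases hy : kp (y - x) = 0
    · simp [hy]
    exact absurd ⟨subset_tsupport _ hx, y - x, subset_tsupport _ hy, x,
        subset_tsupport _ hx, by simp⟩ hxy

lemma limit_eq {G : Set E} (hG : IsOpen G) {α θ : E → ℝ} (hα : IsT α) (hα1 : ∫ x, α x = 1)
    (hθ : IsT θ) (hθG : tsupport θ ⊆ G) {f : (E → ℝ) →ₗ[ℝ] ℝ} (hf : MemG G f) :
    Tendsto (fun k : ℕ => f (cv (scl (2 ^ k) α) θ)) atTop (𝓝 (f θ)) := by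
  obtain ⟨δ, hδ, hδG⟩ := hθ.2.isCompact.exists_cthickening_subset_open hG hθG
  have hKc : IsCompact (Metric.cthickening δ (tsupport θ)) := hθ.2.isCompact.cthickening
  obtain ⟨Fl, h1, h2, h3⟩ := dist_package hf hKc hδG
  obtain ⟨R, hR⟩ := hα.2.isCompact.isBounded.exists_norm_le
  have hpow : Tendsto (fun k : ℕ => ((2 : ℝ) ^ k)⁻¹) atTop (𝓝 0) :=
    (tendsto_pow_atTop_atTop_of_one_lt (one_lt_two : (1 : ℝ) < 2)).inv_tendsto_atTop
  have hcont : Continuous fun t : ℝ => ∫ w, α w * Fl (fun z => θ (z - t • w)) := by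
    rw [← continuousOn_univ]
    refine continuousOn_integral_of_compact_support hα.2.isCompact ?_ ?_
    · have : Continuous fun q : ℝ × E => Fl (fun z => θ (z - q.1 • q.2)) :=
        (h2 θ hθ).comp (by fun_prop : Continuous fun q : ℝ × E => q.1 • q.2)
      exact ((hα.1.continuous.comp continuous_snd).mul this).continuousOn
    · intro t w _ hw
      rw [image_eq_zero_of_notMem_tsupport hw, zero_mul]
  have hlim := (hcont.tendsto 0).comp hpow
  have h0 : ∫ w, α w * Fl (fun z => θ (z - (0 : ℝ) • w)) = f θ := by
    simp only [zero_smul, sub_zero]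
    rw [integral_mul_const, hα1, one_mul, h1 θ hθ (Metric.self_subset_cthickening _)]
  rw [h0] at hlim
  refine hlim.congr' ?_
  have hev : ∀ᶠ k : ℕ in atTop, ((2 : ℝ) ^ k)⁻¹ * R < δ := by
    have := hpow.mul_const R
    rw [zero_mul] at this
    exact this.eventually_lt_const hδ
  filter_upwards [hev] with k hk
  have h2k : (0 : ℝ) < 2 ^ k := by positivity
  have hs := hα.scl h2k
  rw [h1 _ (testFun_cv hs hθ), h3 _ _ hs hθ,
    integral_scl h2k α (fun w => Fl (fun z => θ (z - w)))]
  · rfl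
  · refine (tsupport_cv hs hθ).trans ?_
    rintro _ ⟨w, hw, t, ht, rfl⟩
    refine Metric.mem_cthickening_of_dist_le _ t _ _ ht ?_
    have h4 := hR _ (tsupport_scl w hw)
    rw [norm_smul, Real.norm_eq_abs, abs_of_pos h2k] at h4
    simp only [dist_eq_norm, add_sub_cancel_right]
    refine le_trans ?_ hk.le
    rwa [le_inv_mul_iff₀ h2k]

lemma sum_tendsto {C G : Set E} (hG : IsOpen G) (hGC : ∀ x ∈ G, ∀ c ∈ C, x + c ∈ G)
    (hCs : ∀ c : ℝ, 0 < c → ∀ x ∈ C, c • x ∈ C)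
    {a P0 P A : Module.End ℝ C(E, ℝ)} {φ q0 q α : E → ℝ} (c : ℝ) (hc : c ≠ 0)
    (hφ : IsT φ) (hφC : tsupport φ ⊆ C) (hφa : IsConv (c • a) φ)
    (hq0 : IsT q0) (hq0C : tsupport q0 ⊆ C) (hqa0 : IsConv P0 q0)
    (hq : IsT q) (hqC : tsupport q ⊆ C) (hqa : IsConv P q)
    (hα : IsT α) (hαa : IsConv A α) (hα1 : ∫ x, α x = 1)
    (hA0 : a * P0 = A) (hAP : (a - dl 2⁻¹ * a * dl 2) * P = A - dl 2⁻¹ * A * dl 2)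
    {kf pf : ℕ → E → ℝ} (hk0 : kf 0 = fun x => c⁻¹ * q0 x)
    (hks : ∀ k, kf (k + 1) = scl (2 ^ (k + 1)) (fun x => c⁻¹ * q x))
    (hp0 : pf 0 = φ) (hps : ∀ k, pf (k + 1) = scl (2 ^ (k + 1)) (fun x => φ x - scl 2⁻¹ φ x))
    {f : (E → ℝ) →ₗ[ℝ] ℝ} (hf : MemG G f) {θ : E → ℝ} (hθ : IsT θ) (hθG : tsupport θ ⊆ G) :
    Tendsto (fun K : ℕ => ∑ k ∈ Finset.range K,
      ∫ x, (∫ y, kf k (y - x) * f (fun z => pf k (z - y))) * θ x) atTop (𝓝 (f θ)) := by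
  have hsclC : ∀ {g : E → ℝ} {s : ℝ}, 0 < s → tsupport g ⊆ C → tsupport (scl s g) ⊆ C := by
    intro g s hs hg x hx
    have := hCs s⁻¹ (inv_pos.2 hs) _ (hg (tsupport_scl x hx))
    rwa [inv_smul_smul₀ hs.ne'] at this
  have h2 : (0 : ℝ) < 2⁻¹ := by norm_num
  have hφ2 : IsT (fun x => φ x - scl 2⁻¹ φ x) :=
    ⟨hφ.1.sub (hφ.scl h2).1, hφ.2.sub (hφ.scl h2).2⟩
  have hφ2C : tsupport (fun x => φ x - scl 2⁻¹ φ x) ⊆ C :=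
    (tsupport_sub φ (scl 2⁻¹ φ)).trans (Set.union_subset hφC (hsclC h2 hφC))
  let th : C(E, ℝ) := ⟨θ, hθ.1.continuous⟩
  have hD : IsConv (c • (a - dl 2⁻¹ * a * dl 2)) (fun x => φ x - scl 2⁻¹ φ x) := by
    intro v
    ext x
    have e1 := congrFun (hφa v) x
    have e2 := congrFun (hφa.scl h2 v) x
    rw [inv_inv] at e2
    have e3 : cv (fun x => φ x - scl 2⁻¹ φ x) v x = cv φ v x - cv (scl 2⁻¹ φ) v x := by
      simp only [cv, sub_mul]
      exact integral_sub (integrable_cv hφ v.continuous x)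
        (integrable_cv (hφ.scl h2) v.continuous x)
    rw [e3, ← e1, ← e2]
    change c * (_ - _) = c * _ - c * _
    rw [mul_sub]
    rfl
  have key : ∀ {S T R : Module.End ℝ C(E, ℝ)} {p kp : E → ℝ}, IsConv (c • S) p →
      IsConv T kp → S * T = R → cv p (cv (fun x => c⁻¹ * kp x) θ) = ⇑(R th) := by
    intro S T R p kp hS hT hR
    have e1 : cv (fun x => c⁻¹ * kp x) θ = ⇑((c⁻¹ • T) th) := (hT.smul c⁻¹ th).symm
    rw [e1, ← hS]
    congr 1
    rw [← hR]
    change c • S (c⁻¹ • T th) = S (T th)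
    rw [map_smul, smul_smul, mul_inv_cancel₀ hc, one_smul]
  have hterm0 : ∫ x, (∫ y, kf 0 (y - x) * f (fun z => pf 0 (z - y))) * θ x = f (cv (scl (2 ^ 0) α) θ) := by
    rw [hk0, hp0, term_eq hGC (hq0.const_mul _) hφ hθ ((tsupport_const_mul _).trans hq0C) hφC hθG hf,
      key hφa hqa0 hA0]
    congr 1
    rw [hαa]
    congr 1
    ext x
    simp [scl]
  have hterms : ∀ k, ∫ x, (∫ y, kf (k + 1) (y - x) * f (fun z => pf (k + 1) (z - y))) * θ x =
      f (cv (scl (2 ^ (k + 1)) α) θ) - f (cv (scl (2 ^ k) α) θ) := by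
    intro k
    have hp1 : (0 : ℝ) < 2 ^ (k + 1) := by positivity
    have hp2 : (0 : ℝ) < 2 ^ k := by positivity
    rw [hks, hps, term_eq hGC ((hq.const_mul _).scl hp1) (hφ2.scl hp1) hθ
      (hsclC hp1 ((tsupport_const_mul _).trans hqC)) (hsclC hp1 hφ2C) hθG hf, ← map_sub]
    congr 1
    have e0 : scl (2 ^ (k + 1)) (fun x => c⁻¹ * q x) = fun x => c⁻¹ * scl (2 ^ (k + 1)) q x := by
      ext x
      simp only [scl]
      ring
    have hd1 : (dl ((2 : ℝ) ^ (k + 1))⁻¹ * dl (2 ^ (k + 1)) : Module.End ℝ C(E, ℝ)) = 1 := by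
      rw [dl_mul, inv_mul_cancel₀ hp1.ne', dl_one]
    have hd2 : (dl ((2 : ℝ) ^ (k + 1)) * dl 2⁻¹ : Module.End ℝ C(E, ℝ)) = dl (2 ^ k) := by
      rw [dl_mul]
      congr 1
      rw [pow_succ]
      simp
    have hd3 : (dl 2 * dl ((2 : ℝ) ^ (k + 1))⁻¹ : Module.End ℝ C(E, ℝ)) = dl (2 ^ k)⁻¹ := by
      rw [dl_mul]
      congr 1
      rw [pow_succ]
      field_simp
    have hS := hD.scl hp1
    rw [mul_smul_comm, smul_mul_assoc] at hS
    rw [e0, key hS (hqa.scl hp1) (R := dl (2 ^ (k + 1)) * A * dl (2 ^ (k + 1))⁻¹ -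
      dl (2 ^ k) * A * dl (2 ^ k)⁻¹)]
    · have e1 := hαa.scl hp1 th
      have e2 := hαa.scl hp2 th
      rw [LinearMap.sub_apply]
      ext x
      rw [ContinuousMap.sub_apply, e1, e2]
      rfl
    · calc dl (2 ^ (k + 1)) * (a - dl 2⁻¹ * a * dl 2) * dl (2 ^ (k + 1))⁻¹ *
            (dl (2 ^ (k + 1)) * P * dl (2 ^ (k + 1))⁻¹)
          = dl (2 ^ (k + 1)) * (a - dl 2⁻¹ * a * dl 2) * (dl (2 ^ (k + 1))⁻¹ *
            dl (2 ^ (k + 1))) * P * dl (2 ^ (k + 1))⁻¹ := by simp only [mul_assoc]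
        _ = dl (2 ^ (k + 1)) * ((a - dl 2⁻¹ * a * dl 2) * P) * dl (2 ^ (k + 1))⁻¹ := by
            rw [hd1, mul_one]; simp only [mul_assoc]
        _ = dl (2 ^ (k + 1)) * A * dl (2 ^ (k + 1))⁻¹ - (dl (2 ^ (k + 1)) * dl 2⁻¹) * A *
              (dl 2 * dl (2 ^ (k + 1))⁻¹) := by
            rw [hAP, mul_sub, sub_mul]; simp only [mul_assoc]
        _ = _ := by rw [hd2, hd3]
  have hsum : ∀ K : ℕ, ∑ k ∈ Finset.range (K + 1),
      ∫ x, (∫ y, kf k (y - x) * f (fun z => pf k (z - y))) * θ x = f (cv (scl (2 ^ K) α) θ) := by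
    intro K
    induction K with
    | zero => simpa using hterm0
    | succ K ih => rw [Finset.sum_range_succ, ih, hterms]; ring
  rw [← tendsto_add_atTop_iff_nat 1]
  simp only [hsum]
  exact limit_eq hG hα hα1 hθ hθG hf

end generic3

lemma sqNorm_eq (d : ℕ) (y : Fin d → ℝ) : sqNorm d y = ‖(WithLp.toLp 2 y : EuclideanSpace ℝ (Fin d))‖ := by
  rw [EuclideanSpace.norm_eq]
  simp [sqNorm]

lemma sqNorm_add (d : ℕ) (y z : Fin d → ℝ) : sqNorm d (y + z) ≤ sqNorm d y + sqNorm d z := by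
  simp only [sqNorm_eq, WithLp.toLp_add]
  exact norm_add_le _ _

lemma sqNorm_smul (d : ℕ) {c : ℝ} (hc : 0 ≤ c) (y : Fin d → ℝ) :
    sqNorm d (c • y) = c * sqNorm d y := by
  simp only [sqNorm_eq, WithLp.toLp_smul, norm_smul, Real.norm_eq_abs, abs_of_nonneg hc]

lemma sqNorm_neg (d : ℕ) (y : Fin d → ℝ) : sqNorm d (-y) = sqNorm d y := by
  simp only [sqNorm_eq, WithLp.toLp_neg, norm_neg]

lemma continuous_lip {d : ℕ} {M : ℝ} {ϖ : (Fin d → ℝ) → ℝ} (hϖ : IsLipFun d M ϖ) :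
    Continuous ϖ := by
  rw [continuous_iff_continuousAt]
  intro z
  have h1 : Continuous fun y : Fin d → ℝ => M * sqNorm d (fun i => y i - z i) := by
    unfold sqNorm
    fun_prop
  have h2 := h1.tendsto z
  simp only [sub_self, sqNorm] at h2
  norm_num at h2
  rw [ContinuousAt, tendsto_iff_dist_tendsto_zero]
  exact squeeze_zero (fun _ => dist_nonneg) (fun y => hϖ y z) h2

lemma isOpen_specialLip {d : ℕ} {M : ℝ} {ϖ : (Fin d → ℝ) → ℝ} (hϖ : IsLipFun d M ϖ) :
    IsOpen (specialLip d ϖ) := by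
  have h1 : Continuous (lowerPart d) := by unfold lowerPart; fun_prop
  exact isOpen_lt ((continuous_lip hϖ).comp h1) (continuous_apply _)

lemma WW_monomial {ι : Type*} [Fintype ι] (β : ι → ℕ) (s : Finset ι) :
    WW (∑ i ∈ s, β i + 1) (fun x : ι → ℝ => ∏ i ∈ s, x i ^ β i) := by
  classical
  induction s using Finset.induction_on with
  | empty =>
    intro h
    ext x
    simp
  | insert i s hi ih =>
    rw [Finset.sum_insert hi]
    simp only [Finset.prod_insert hi]
    induction β i with
    | zero => simpa using ih
    | succ b ihb =>
      have := ihb.mul_linear (LinearMap.proj i : (ι → ℝ) →ₗ[ℝ] ℝ)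
      convert this using 1
      · ring
      · ext x
        simp only [LinearMap.proj_apply]
        ring

lemma WW_mono {ι : Type*} [Fintype ι] {u : (ι → ℝ) → ℝ} {j k : ℕ} (h : j ≤ k) (hu : WW j u) :
    WW k u := by
  induction h with
  | refl => exact hu
  | step _ ih => exact ih.succ

lemma IsT.comp_neg {n : ℕ} {g : (Fin n → ℝ) → ℝ} (hg : IsT g) : IsT (fun x => g (-x)) :=
  ⟨hg.1.comp (by fun_prop), hg.2.comp_homeomorph (Homeomorph.neg _)⟩

lemma tsupport_comp_neg {n : ℕ} {g : (Fin n → ℝ) → ℝ} :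
    ∀ x ∈ tsupport (fun x => g (-x)), -x ∈ tsupport g := by
  intro x hx
  have : tsupport (fun x => g (-x)) ⊆ (fun x => -x) ⁻¹' tsupport g := by
    apply closure_minimal
    · intro w hw
      exact subset_tsupport _ hw
    · exact (isClosed_tsupport g).preimage (by fun_prop)
  exact this hx

/-- Lemma 3.2, the local reproducing formula on a special Lipschitz domain. -/
theorem local_reproducing_formula (d : ℕ)
    (M : ℝ) (hM : 1 ≤ M) (ϖ : (Fin d → ℝ) → ℝ) (hϖ : IsLipFun d M ϖ)
    (φ₀ : (Fin (d + 1) → ℝ) → ℝ) (hφ₀ : IsTestFun (d + 1) φ₀)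
    (hsupp : tsupport φ₀ ⊆ negConeK d M) (hint : (∫ x, φ₀ x) ≠ 0)
    (L : ℕ) :
    ∃ ψ₀ ψ : (Fin (d + 1) → ℝ) → ℝ,
      IsTestFun (d + 1) ψ₀ ∧ tsupport ψ₀ ⊆ negConeK d M ∧
      IsTestFun (d + 1) ψ ∧ tsupport ψ ⊆ negConeK d M ∧
      MomentsVanish (d + 1) (L : ℤ) ψ ∧
      ∀ f : Dstrb (d + 1), MemD' (d + 1) (specialLip d ϖ) f →
        ∀ θ : (Fin (d + 1) → ℝ) → ℝ, IsTestFun (d + 1) θ →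
          tsupport θ ⊆ specialLip d ϖ →
          Filter.Tendsto
            (fun K : ℕ => ∑ k ∈ Finset.range K,
              ∫ x, (∫ y, kernFam (d + 1) ψ₀ ψ k (x - y) *
                distConv (d + 1) f (phiFam (d + 1) φ₀ k) y) * θ x)
            Filter.atTop (nhds (f θ)) := by
  set C : Set (Fin (d + 1) → ℝ) := {x | -x ∈ negConeK d M} with hCdef
  have hmem : ∀ x, x ∈ C ↔ M * sqNorm d (lowerPart d x) < x (Fin.last d) := by
    intro x
    have : lowerPart d (-x) = -lowerPart d x := rfl
    simp only [hCdef, Set.mem_setOf_eq, negConeK, this, sqNorm_neg, Pi.neg_apply, neg_neg]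
  have hM0 : 0 ≤ M := by linarith
  have hCadd : ∀ x ∈ C, ∀ y ∈ C, x + y ∈ C := by
    intro x hx y hy
    rw [hmem] at *
    have h1 := mul_le_mul_of_nonneg_left (sqNorm_add d (lowerPart d x) (lowerPart d y)) hM0
    have h2 : lowerPart d (x + y) = lowerPart d x + lowerPart d y := rfl
    rw [h2, Pi.add_apply]
    linarith
  have hCs : ∀ c : ℝ, 0 < c → ∀ x ∈ C, c • x ∈ C := by
    intro c hc x hx
    rw [hmem] at *
    have h2 : lowerPart d (c • x) = c • lowerPart d x := rfl
    rw [h2, sqNorm_smul d hc.le, Pi.smul_apply, smul_eq_mul]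
    have := mul_lt_mul_of_pos_left hx hc
    linarith
  have hGC : ∀ x ∈ specialLip d ϖ, ∀ c ∈ C, x + c ∈ specialLip d ϖ := by
    intro x hx c hc
    rw [hmem] at hc
    have h1 := (abs_le.1 (hϖ (lowerPart d (x + c)) (lowerPart d x))).2
    have h2 : (fun i => lowerPart d (x + c) i - lowerPart d x i) = lowerPart d c := by
      ext i
      simp [lowerPart]
    rw [h2] at h1
    have hx' : ϖ (lowerPart d x) < x (Fin.last d) := hx
    change ϖ (lowerPart d (x + c)) < x (Fin.last d) + c (Fin.last d)
    linarith
  set c : ℝ := ∫ x, φ₀ x with hc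
  set φ : (Fin (d + 1) → ℝ) → ℝ := fun x => φ₀ (-x) with hφdef
  have hφ : IsT φ := IsT.comp_neg hφ₀
  have hφC : tsupport φ ⊆ C := fun x hx => hsupp (tsupport_comp_neg x hx)
  have hφi : ∫ x, φ x = c := integral_neg_eq_self φ₀ volume
  have hg : IsT (fun x => c⁻¹ * φ x) := hφ.const_mul _
  have hgC : tsupport (fun x => c⁻¹ * φ x) ⊆ C := (tsupport_const_mul _).trans hφC
  have hgi : ∫ x, c⁻¹ * φ x = 1 := by
    rw [integral_const_mul, hφi, inv_mul_cancel₀ hint]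
  set a := cvEnd _ hg with ha
  have haC : IsConv a (fun x => c⁻¹ * φ x) := isConv_cvEnd _ hg
  have h2 : (0 : ℝ) < 2⁻¹ := by norm_num
  have hbC : IsConv (dl 2⁻¹ * a * dl 2) (scl 2⁻¹ (fun x => c⁻¹ * φ x)) := by
    have := haC.scl h2
    rwa [inv_inv] at this
  have hgC' : tsupport (scl 2⁻¹ (fun x => c⁻¹ * φ x)) ⊆ C := by
    intro x hx
    have := hCs 2 two_pos _ (hgC (tsupport_scl x hx))
    rwa [smul_inv_smul₀ two_ne_zero] at this
  have hgi' : ∫ x, scl 2⁻¹ (fun x => c⁻¹ * φ x) x = 1 := by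
    have := integral_scl h2 (fun x => c⁻¹ * φ x) (fun _ => 1)
    simpa only [mul_one, hgi] using this
  obtain ⟨A, P0, P, ⟨α, hα, hαC, hαA⟩, ⟨q0, hq0, hq0C, hq0P⟩, ⟨q, hq, hqC, hqP⟩, hA0, hAP, hA1, hP0⟩ :=
    op_exists hCadd hg hgC hgi haC (hg.scl h2) hgC' hgi' hbC rfl L
  have hα1 : ∫ x, α x = 1 := by
    have h1 := hA1 1 (WW_mono (j := 1) (by omega) (by intro h; ext x; simp))
    have h3 := congrFun (hαA 1) 0
    rw [h1] at h3
    simpa [cv] using h3.symm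
  have hneg : ∀ {r : (Fin (d + 1) → ℝ) → ℝ}, tsupport r ⊆ C →
      tsupport (fun x => c⁻¹ * r (-x)) ⊆ negConeK d M := by
    intro r hr x hx
    have h1 : tsupport (fun x => c⁻¹ * r (-x)) ⊆ tsupport (fun x => r (-x)) :=
      tsupport_mul_subset_right
    have h3 : - -x ∈ negConeK d M := hr (tsupport_comp_neg x (h1 hx))
    rwa [neg_neg] at h3
  refine ⟨fun x => c⁻¹ * q0 (-x), fun x => c⁻¹ * q (-x), hq0.comp_neg.const_mul _, hneg hq0C,
    hq.comp_neg.const_mul _, hneg hqC, ?_, ?_⟩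
  · intro β hβ
    have hβ' : ∑ i, β i ≤ L := by exact_mod_cast hβ
    let v : C(Fin (d + 1) → ℝ, ℝ) := ⟨fun x => ∏ i, x i ^ β i, by fun_prop⟩
    have h1 : P v = 0 := hP0 v (WW_mono (Nat.succ_le_succ hβ') (WW_monomial β Finset.univ))
    have h3 := congrFun (hqP v) 0
    rw [h1] at h3
    rw [← integral_neg_eq_self]
    have h4 : ∀ x : Fin (d + 1) → ℝ, (∏ i, (-x) i ^ β i) * (c⁻¹ * q (- -x)) =
        c⁻¹ * (q x * v (0 - x)) := by
      intro x
      rw [neg_neg, zero_sub]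
      change _ = c⁻¹ * (q x * ∏ i, (-x) i ^ β i)
      ring
    simp only [h4]
    rw [integral_const_mul]
    change c⁻¹ * cv q v 0 = 0
    rw [← h3]
    simp
  · intro f hf θ hθ hθG
    have hpow : ∀ k : ℕ, (2 : ℝ) ^ ((k + 1) * (d + 1)) =
        (2 ^ (k + 1)) ^ Module.finrank ℝ (Fin (d + 1) → ℝ) := by
      intro k
      rw [Module.finrank_fin_fun, pow_mul]
    have hφa : IsConv (c • a) φ := by
      have := haC.smul c
      simpa only [mul_inv_cancel_left₀ hint] using this
    have := sum_tendsto (isOpen_specialLip hϖ) hGC hCs c hint hφ hφC hφa hq0 hq0C hq0P hq hqC hqP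
      hα hαA hα1 hA0 hAP
      (kf := fun k w => kernFam (d + 1) (fun x => c⁻¹ * q0 (-x)) (fun x => c⁻¹ * q (-x)) k (-w))
      (pf := fun k w => phiFam (d + 1) φ₀ k (-w))
      (by ext x; simp [kernFam])
      (by
        intro k
        ext x
        simp only [kernFam, scl, hpow, smul_neg, neg_neg])
      (by ext x; simp [phiFam, hφdef])
      (by
        intro k
        ext x
        simp only [phiFam, phiOf, scl, hpow, smul_neg, hφdef, Module.finrank_fin_fun])
      (f := f) hf hθ hθG
    simpa only [distConv, neg_sub] using this
end
end

section
/- Let p, q, σ₁, σ₂ ∈ (0,∞], α₁, α₂ ∈ ℝ, α₃ ≥ 0, {t_k} ∈ 𝒳^{α₃}_{α,σ,p} (α = (α₁,α₂), σ = (σ₁,σ₂)), and let φ₀ ∈ D(ℝⁿ) with ∫φ₀ = 1. Then the space B^{φ₀}_{p,q}({t_k}) is a complete quasi-normed vector space which is continuously embedded into S'_e; in particular there exist constants C, N, L > 0 (depending on {t_k}, p, q, n, φ₀ but not on f or θ) such that |⟨f, θ⟩| ≤ C ‖f | B^{φ₀}_{p,q}({t_k})‖ · sup_{x∈ℝⁿ}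 (Σ_{|β| ≤ L} |D^β θ(x)|) e^{N|x|} for all f ∈ B^{φ₀}_{p,q}({t_k}) and all θ ∈ D(ℝⁿ). -/
open MeasureTheory ENNReal Filter Topology

noncomputable section

section derivInt

variable {n : ℕ} {F : Type*} [NormedAddCommGroup F] [NormedSpace ℝ F] [CompleteSpace F]

set_option linter.unusedSectionVars false

theorem integrable_smul_shift {h : (Fin n → ℝ) → ℝ} (hh : Integrable h)
    {l : (Fin n → ℝ) → (Fin n → ℝ)} (hl : Measurable l) {Θ : (Fin n → ℝ) → F}
    (hΘ : Continuous Θ) (hc : HasCompactSupport Θ) (y : Fin n → ℝ) :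
    Integrable (fun z => h z • Θ (y + l z)) := by
  obtain ⟨C, hC⟩ := hc.exists_bound_of_continuous hΘ
  refine (hh.norm.mul_const C).mono' (hh.1.smul ?_) (Eventually.of_forall fun z => ?_)
  swap
  · rw [norm_smul]; gcongr; exact hC _
  exact (hΘ.stronglyMeasurable.comp_measurable (measurable_const.add hl)).aestronglyMeasurable

theorem hasFDerivAt_smul_shift {h : (Fin n → ℝ) → ℝ} (hh : Integrable h)
    {l : (Fin n → ℝ) → (Fin n → ℝ)} (hl : Measurable l) {Θ : (Fin n → ℝ) → F}
    (hΘ : ContDiff ℝ 1 Θ) (hc : HasCompactSupport Θ) (y : Fin n → ℝ) :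
    HasFDerivAt (fun y => ∫ z, h z • Θ (y + l z)) (∫ z, h z • fderiv ℝ Θ (y + l z)) y := by
  have hc' := hc.fderiv (𝕜 := ℝ)
  have hcont : Continuous (fderiv ℝ Θ) := hΘ.continuous_fderiv one_ne_zero
  obtain ⟨C, hC⟩ := hc'.exists_bound_of_continuous hcont
  refine hasFDerivAt_integral_of_dominated_of_fderiv_le (s := Set.univ)
    (bound := fun z => ‖h z‖ * C) (F' := fun y z => h z • fderiv ℝ Θ (y + l z)) univ_mem
    (Eventually.of_forall fun x => (integrable_smul_shift hh hl hΘ.continuous hc x).1)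
    (integrable_smul_shift hh hl hΘ.continuous hc y)
    (integrable_smul_shift hh hl hcont hc' y).1
    (Eventually.of_forall fun z x _ => ?_) (hh.norm.mul_const C)
    (Eventually.of_forall fun z x _ => ?_)
  · rw [norm_smul]; gcongr; exact hC _
  · have : HasFDerivAt Θ (fderiv ℝ Θ (x + l z)) (x + l z) :=
      (hΘ.differentiable one_ne_zero _).hasFDerivAt
    have h2 := this.comp x ((hasFDerivAt_id x).add_const (l z))
    exact h2.const_smul (h z)

theorem lie_integral_smul {α G G' : Type*} [MeasurableSpace α] {μ : Measure α}
    [NormedAddCommGroup G] [NormedSpace ℝ G] [NormedAddCommGroup G'] [NormedSpace ℝ G']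
    (L : G ≃ₗᵢ[ℝ] G') (h : α → ℝ) (g : α → G) :
    L (∫ z, h z • g z ∂μ) = ∫ z, h z • L (g z) ∂μ := by
  have := L.toContinuousLinearEquiv.integral_comp_comm (μ := μ) (fun z => h z • g z)
  simpa using this.symm

end derivInt

/-- generalized averaging operator -/
def Iop {n : ℕ} (h : (Fin n → ℝ) → ℝ) (l : (Fin n → ℝ) → (Fin n → ℝ)) (θ : (Fin n → ℝ) → ℝ)
    (y : Fin n → ℝ) : ℝ := ∫ z, h z * θ (y + l z)

theorem iteratedFDeriv_Iop {n : ℕ} {h : (Fin n → ℝ) → ℝ} (hh : Integrable h)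
    {l : (Fin n → ℝ) → (Fin n → ℝ)} (hl : Measurable l) {θ : (Fin n → ℝ) → ℝ}
    (hθ : IsTestFun n θ) (i : ℕ) :
    iteratedFDeriv ℝ i (Iop h l θ) = fun y => ∫ z, h z • iteratedFDeriv ℝ i θ (y + l z) := by
  induction i with
  | zero =>
    funext y
    rw [iteratedFDeriv_zero_eq_comp, iteratedFDeriv_zero_eq_comp]
    simp only [Function.comp_apply, Iop]
    exact lie_integral_smul _ h (fun z => θ (y + l z))
  | succ i ih =>
    funext y
    rw [iteratedFDeriv_succ_eq_comp_left, iteratedFDeriv_succ_eq_comp_left, ih]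
    simp only [Function.comp_apply]
    have h1 : ContDiff ℝ 1 (iteratedFDeriv ℝ i θ) :=
      hθ.1.iteratedFDeriv_right (by norm_cast; exact le_top)
    rw [(hasFDerivAt_smul_shift hh hl h1 (hθ.2.iteratedFDeriv i) y).fderiv]
    exact lie_integral_smul (G := (Fin n → ℝ) →L[ℝ] (Fin n → ℝ) [×i]→L[ℝ] ℝ)
      (G' := (Fin n → ℝ) [×(i + 1)]→L[ℝ] ℝ)
      (continuousMultilinearCurryLeftEquiv ℝ (fun _ : Fin (i + 1) => Fin n → ℝ) ℝ).symm h _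

theorem contDiff_Iop {n : ℕ} {h : (Fin n → ℝ) → ℝ} (hh : Integrable h)
    {l : (Fin n → ℝ) → (Fin n → ℝ)} (hl : Measurable l) {θ : (Fin n → ℝ) → ℝ}
    (hθ : IsTestFun n θ) : ContDiff ℝ (⊤ : ℕ∞) (Iop h l θ) := by
  refine contDiff_of_differentiable_iteratedFDeriv fun m _ => ?_
  rw [iteratedFDeriv_Iop hh hl hθ]
  intro y
  have h1 : ContDiff ℝ 1 (iteratedFDeriv ℝ m θ) :=
      hθ.1.iteratedFDeriv_right (by norm_cast; exact le_top)
  exact (hasFDerivAt_smul_shift hh hl h1 (hθ.2.iteratedFDeriv m) y).differentiableAt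

theorem isTestFun_bound {n : ℕ} {θ : (Fin n → ℝ) → ℝ} (hθ : IsTestFun n θ) :
    ∃ R : ℝ, 0 ≤ R ∧ ∀ x, R < ‖x‖ → θ x = 0 := by
  obtain ⟨R, hR⟩ := hθ.2.isCompact.isBounded.exists_norm_le
  refine ⟨max R 0, le_max_right _ _, fun x hx => ?_⟩
  by_contra h
  have := hR x (subset_tsupport _ h)
  exact absurd (this.trans (le_max_left _ _)) (not_le.2 hx)

theorem isTestFun_Iop {n : ℕ} {h : (Fin n → ℝ) → ℝ} (hh : Integrable h)
    {l : (Fin n → ℝ) → (Fin n → ℝ)} (hl : Measurable l) {θ : (Fin n → ℝ) → ℝ}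
    (hθ : IsTestFun n θ) (R : ℝ) (hR : ∀ z, h z ≠ 0 → ‖l z‖ ≤ R) : IsTestFun n (Iop h l θ) := by
  refine ⟨contDiff_Iop hh hl hθ, ?_⟩
  obtain ⟨R', _, hR'⟩ := isTestFun_bound hθ
  refine HasCompactSupport.of_support_subset_isCompact (isCompact_closedBall 0 (R' + R)) ?_
  intro y hy
  rw [mem_closedBall_zero_iff]
  by_contra hcon
  push Not at hcon
  refine hy ?_
  have : ∀ z, h z * θ (y + l z) = 0 := by
    intro z
    by_cases hz : h z = 0
    · simp [hz]
    · rw [hR' _, mul_zero]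
      have := norm_sub_norm_le y (-l z)
      rw [norm_neg, sub_neg_eq_add] at this
      linarith [hR z hz]
  simp [Iop, this]

/-- weighted derivative bound -/
def Dec {n : ℕ} (a : ℝ) (m : ℕ) (θ : (Fin n → ℝ) → ℝ) (s : ℝ) : Prop :=
  ∀ i ≤ m, ∀ x, ‖iteratedFDeriv ℝ i θ x‖ ≤ s * Real.exp (-(a * ‖x‖))

theorem Dec.nonneg {n : ℕ} {a : ℝ} {m : ℕ} {θ : (Fin n → ℝ) → ℝ} {s : ℝ} (h : Dec a m θ s) :
    0 ≤ s := by
  have := (norm_nonneg _).trans (h 0 (Nat.zero_le _) 0)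
  simpa using this

theorem Dec.mono {n : ℕ} {a a' : ℝ} {m m' : ℕ} {θ : (Fin n → ℝ) → ℝ} {s s' : ℝ}
    (h : Dec a m θ s) (ha : a' ≤ a) (hm : m' ≤ m) (hs : s ≤ s') : Dec a' m' θ s' := by
  intro i hi x
  have h0 := h.nonneg
  refine (h i (hi.trans hm) x).trans ?_
  have : 0 ≤ s' := h0.trans hs
  gcongr

theorem Dec.add {n : ℕ} {a : ℝ} {m : ℕ} {θ θ' : (Fin n → ℝ) → ℝ} {s s' : ℝ}
    (hθ : ContDiff ℝ (⊤ : ℕ∞) θ) (hθ' : ContDiff ℝ (⊤ : ℕ∞) θ')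
    (h : Dec a m θ s) (h' : Dec a m θ' s') : Dec a m (θ + θ') (s + s') := by
  intro i hi x
  rw [iteratedFDeriv_add_apply]
  · rw [add_mul]
    exact (norm_add_le _ _).trans (add_le_add (h i hi x) (h' i hi x))
  · exact (hθ.of_le (by exact_mod_cast le_top)).contDiffAt
  · exact (hθ'.of_le (by exact_mod_cast le_top)).contDiffAt

theorem exists_Dec {n : ℕ} {θ : (Fin n → ℝ) → ℝ} (hθ : IsTestFun n θ) (a : ℝ) (m : ℕ) :
    ∃ s, Dec a m θ s := by
  have : ∀ i : ℕ, ∃ C : ℝ, 0 ≤ C ∧ ∀ x, ‖iteratedFDeriv ℝ i θ x‖ ≤ C * Real.exp (-(a * ‖x‖)) := by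
    intro i
    have hcont : Continuous (fun x => Real.exp (a * ‖x‖) • iteratedFDeriv ℝ i θ x) := by
      have := hθ.1.continuous_iteratedFDeriv (m := i) (by exact_mod_cast le_top)
      fun_prop
    obtain ⟨C, hC⟩ := (((hθ.2.iteratedFDeriv (𝕜 := ℝ) i).smul_left
      (f := fun x => Real.exp (a * ‖x‖)))).exists_bound_of_continuous hcont
    refine ⟨C, (norm_nonneg _).trans (hC 0), fun x => ?_⟩
    have := hC x
    simp only [Pi.smul_apply', norm_smul, Real.norm_eq_abs, Real.abs_exp] at this
    rw [Real.exp_neg, ← div_eq_mul_inv, le_div_iff₀ (Real.exp_pos _), mul_comm]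
    exact this
  choose C hC0 hC using this
  refine ⟨∑ i ∈ Finset.range (m + 1), C i, fun i hi x => (hC i x).trans ?_⟩
  gcongr
  exact Finset.single_le_sum (f := C) (fun i _ => hC0 i) (Finset.mem_range.2 (by omega))

/-- Mean value estimate with weights -/
theorem norm_iterated_sub_le {n : ℕ} {θ : (Fin n → ℝ) → ℝ} (hθ : ContDiff ℝ (⊤ : ℕ∞) θ) {a s : ℝ}
    {m : ℕ} (ha : 0 ≤ a) (h : Dec a (m + 1) θ s) {i : ℕ} (hi : i ≤ m) (y w : Fin n → ℝ) (R : ℝ)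
    (hw : ‖w‖ ≤ R) :
    ‖iteratedFDeriv ℝ i θ (y + w) - iteratedFDeriv ℝ i θ y‖ ≤
      s * Real.exp (a * R) * Real.exp (-(a * ‖y‖)) * ‖w‖ := by
  have hd : Differentiable ℝ (iteratedFDeriv ℝ i θ) :=
    hθ.differentiable_iteratedFDeriv (by exact_mod_cast WithTop.coe_lt_top i)
  have := (convex_closedBall y R).norm_image_sub_le_of_norm_fderiv_le (𝕜 := ℝ)
    (f := iteratedFDeriv ℝ i θ) (C := s * Real.exp (a * R) * Real.exp (-(a * ‖y‖)))
    (x := y) (y := y + w)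
    (fun x _ => hd x) (fun x hx => ?_)
    (Metric.mem_closedBall_self ((norm_nonneg _).trans hw)) (by simpa using hw)
  · simpa using this
  · rw [norm_fderiv_iteratedFDeriv]
    refine (h (i + 1) (by omega) x).trans ?_
    rw [mul_assoc, ← Real.exp_add]
    have := h.nonneg
    gcongr
    rw [mem_closedBall_iff_norm] at hx
    have := norm_sub_norm_le y x
    rw [norm_sub_rev] at this
    nlinarith


/-- boundedness of a functional on test functions -/
def Bd {n : ℕ} (f : Dstrb n) (N : ℕ) (K : ℝ) : Prop :=
  0 ≤ K ∧ ∀ θ, IsTestFun n θ → ∀ s, Dec N N θ s → |f θ| ≤ K * s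

theorem isTestFun_add {n : ℕ} {θ θ' : (Fin n → ℝ) → ℝ} (h : IsTestFun n θ) (h' : IsTestFun n θ') :
    IsTestFun n (θ + θ') := ⟨h.1.add h'.1, h.2.add h'.2⟩

theorem isTestFun_smul {n : ℕ} {θ : (Fin n → ℝ) → ℝ} (c : ℝ) (h : IsTestFun n θ) :
    IsTestFun n (c • θ) := ⟨contDiff_const.smul h.1, h.2.smul_left (f := fun _ => c)⟩

theorem isTestFun_neg {n : ℕ} {θ : (Fin n → ℝ) → ℝ} (h : IsTestFun n θ) :
    IsTestFun n (-θ) := by simpa using isTestFun_smul (-1) h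

theorem isTestFun_sub {n : ℕ} {θ θ' : (Fin n → ℝ) → ℝ} (h : IsTestFun n θ) (h' : IsTestFun n θ') :
    IsTestFun n (θ - θ') := by
  rw [sub_eq_add_neg]; exact isTestFun_add h (isTestFun_neg h')

theorem isTestFun_shift {n : ℕ} {θ : (Fin n → ℝ) → ℝ} (h : IsTestFun n θ) (v : Fin n → ℝ) :
    IsTestFun n (fun y => θ (y + v)) :=
  ⟨h.1.comp (contDiff_id.add contDiff_const), h.2.comp_homeomorph (Homeomorph.addRight v)⟩

theorem isTestFun_scale {n : ℕ} {θ : (Fin n → ℝ) → ℝ} (h : IsTestFun n θ) (c : ℝ) (hc : c ≠ 0) :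
    IsTestFun n (fun y => θ (c • y)) :=
  ⟨h.1.comp (contDiff_const_smul c), h.2.comp_homeomorph (Homeomorph.smulOfNeZero c hc)⟩

theorem Dec_shift_sub {n : ℕ} {θ : (Fin n → ℝ) → ℝ} (hθ : IsTestFun n θ) {a s : ℝ}
    {m : ℕ} (ha : 0 ≤ a) (h : Dec a (m + 1) θ s) (v v₀ : Fin n → ℝ) (R R' : ℝ)
    (hw : ‖v - v₀‖ ≤ R) (hv₀ : ‖v₀‖ ≤ R') {i : ℕ} (hi : i ≤ m) (y : Fin n → ℝ) :
    ‖iteratedFDeriv ℝ i θ (y + v) - iteratedFDeriv ℝ i θ (y + v₀)‖ ≤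
      (s * Real.exp (a * (R + R')) * ‖v - v₀‖) * Real.exp (-(a * ‖y‖)) := by
  have h1 := norm_iterated_sub_le hθ.1 ha h hi (y + v₀) (v - v₀) R hw
  rw [show y + v₀ + (v - v₀) = y + v by abel] at h1
  refine h1.trans ?_
  have h0 := h.nonneg
  have : Real.exp (a * R) * Real.exp (-(a * ‖y + v₀‖)) ≤
      Real.exp (a * (R + R')) * Real.exp (-(a * ‖y‖)) := by
    rw [← Real.exp_add, ← Real.exp_add]
    apply Real.exp_le_exp.2
    have := norm_sub_le (y + v₀) v₀
    rw [add_sub_cancel_right] at this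
    nlinarith
  calc _ = s * ‖v - v₀‖ * (Real.exp (a * R) * Real.exp (-(a * ‖y + v₀‖))) := by ring
    _ ≤ s * ‖v - v₀‖ * (Real.exp (a * (R + R')) * Real.exp (-(a * ‖y‖))) := by gcongr
    _ = _ := by ring

theorem continuous_shift {n : ℕ} {f : Dstrb n} {N : ℕ} {K : ℝ} (hf : Bd f N K)
    {θ : (Fin n → ℝ) → ℝ} (hθ : IsTestFun n θ) :
    Continuous (fun v => f (fun y => θ (y + v))) := by
  rw [continuous_iff_continuousAt]
  intro v₀
  obtain ⟨s, hs⟩ := exists_Dec hθ N (N + 1)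
  unfold ContinuousAt
  rw [tendsto_iff_norm_sub_tendsto_zero]
  have hlim : Tendsto (fun v => K * (s * Real.exp (N * (1 + ‖v₀‖)) * ‖v - v₀‖)) (𝓝 v₀) (𝓝 0) := by
    have : Continuous (fun v => K * (s * Real.exp (N * (1 + ‖v₀‖)) * ‖v - v₀‖)) := by fun_prop
    simpa using this.tendsto v₀
  refine squeeze_zero' (Eventually.of_forall fun _ => norm_nonneg _) ?_ hlim
  filter_upwards [Metric.closedBall_mem_nhds v₀ one_pos] with v hv
  rw [← map_sub, Real.norm_eq_abs]
  refine hf.2 _ (isTestFun_sub (isTestFun_shift hθ v) (isTestFun_shift hθ v₀)) _ ?_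
  intro i hi y
  rw [iteratedFDeriv_sub_apply, iteratedFDeriv_comp_add_right, iteratedFDeriv_comp_add_right]
  · exact Dec_shift_sub hθ (Nat.cast_nonneg N) hs v v₀ 1 _ (mem_closedBall_iff_norm.1 hv) le_rfl hi y
  · exact ((isTestFun_shift hθ v).1.of_le (by exact_mod_cast le_top)).contDiffAt
  · exact ((isTestFun_shift hθ v₀).1.of_le (by exact_mod_cast le_top)).contDiffAt

theorem simple_integral {n : ℕ} (h : (Fin n → ℝ) → ℝ) (hh : Integrable h)
    (l : SimpleFunc (Fin n → ℝ) (Fin n → ℝ)) (G : (Fin n → ℝ) → ℝ) :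
    ∫ z, h z * G (l z) = ∑ c ∈ l.range, (∫ z in l ⁻¹' {c}, h z) * G c := by
  have h1 : ∀ z, h z * G (l z) = ∑ c ∈ l.range, (l ⁻¹' {c}).indicator h z * G c := by
    intro z
    rw [Finset.sum_eq_single (l z)]
    · simp
    · intro c _ hc
      rw [Set.indicator_of_notMem, zero_mul]
      simpa using hc.symm
    · intro hc; exact absurd (l.mem_range_self z) hc
  simp_rw [h1]
  rw [integral_finsetSum]
  · refine Finset.sum_congr rfl fun c _ => ?_
    rw [integral_mul_const, integral_indicator (l.measurableSet_fiber c)]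
  · intro c _
    exact (hh.indicator (l.measurableSet_fiber c)).mul_const _

/-- exchange of functional and integral -/
theorem exchange {n : ℕ} {f : Dstrb n} {N : ℕ} {K : ℝ} (hf : Bd f N K)
    {θ : (Fin n → ℝ) → ℝ} (hθ : IsTestFun n θ) {h : (Fin n → ℝ) → ℝ} (hh : Integrable h)
    {l : (Fin n → ℝ) → (Fin n → ℝ)} (hl : Measurable l) (R : ℝ) (hR0 : 0 ≤ R)
    (hR : ∀ z, h z ≠ 0 → ‖l z‖ ≤ R) :
    f (Iop h l θ) = ∫ z, h z * f (fun y => θ (y + l z)) := by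
  obtain ⟨s, hs⟩ := exists_Dec hθ N (N + 1)
  have hs0 := hs.nonneg
  set ls : ℕ → SimpleFunc (Fin n → ℝ) (Fin n → ℝ) :=
    fun j => SimpleFunc.approxOn l hl Set.univ 0 (Set.mem_univ _) j with hls
  have hlim : ∀ z, Tendsto (fun j => ls j z) atTop (𝓝 (l z)) := fun z =>
    SimpleFunc.tendsto_approxOn hl _ (by simp)
  have hbd : ∀ j z, ‖ls j z‖ ≤ 2 * ‖l z‖ := fun j z => by
    have := SimpleFunc.norm_approxOn_zero_le hl (Set.mem_univ _) z j
    rw [two_mul]; exact this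
  have hcont := continuous_shift hf hθ
  have hsimp : ∀ j, f (Iop h (ls j) θ) = ∫ z, h z * f (fun y => θ (y + ls j z)) := by
    intro j
    rw [simple_integral h hh (ls j) (fun c => f (fun y => θ (y + c)))]
    have : Iop h (ls j) θ = ∑ c ∈ (ls j).range, (∫ z in (ls j) ⁻¹' {c}, h z) •
        (fun y => θ (y + c)) := by
      funext y
      rw [Finset.sum_apply]
      exact simple_integral h hh (ls j) (fun c => θ (y + c))
    rw [this, map_sum]
    simp
  have hl1 : Tendsto (fun j => ∫ z, h z * f (fun y => θ (y + ls j z))) atTop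
      (𝓝 (∫ z, h z * f (fun y => θ (y + l z)))) := by
    obtain ⟨C, hC⟩ := (isCompact_closedBall (0 : Fin n → ℝ) (2 * R)).exists_bound_of_continuousOn
      hcont.continuousOn
    refine tendsto_integral_of_dominated_convergence (fun z => ‖h z‖ * C) (fun j => ?_)
      (hh.norm.mul_const C) (fun j => Eventually.of_forall fun z => ?_)
      (Eventually.of_forall fun z => ?_)
    · exact hh.1.mul (hcont.measurable.comp (ls j).measurable).aestronglyMeasurable
    · rw [norm_mul]
      by_cases hz : h z = 0
      · simp [hz]
      · gcongr
        apply hC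
        rw [mem_closedBall_zero_iff]
        linarith [hbd j z, hR z hz]
    · exact ((hcont.tendsto _).comp (hlim z)).const_mul _
  have hl2 : Tendsto (fun j => f (Iop h (ls j) θ)) atTop (𝓝 (f (Iop h l θ))) := by
    rw [tendsto_iff_norm_sub_tendsto_zero]
    set c := s * Real.exp (N * (3 * R + 2 * R)) with hc
    have hI : Tendsto (fun j => K * (∫ z, ‖h z‖ * (c * ‖ls j z - l z‖))) atTop (𝓝 0) := by
      have : Tendsto (fun j => ∫ z, ‖h z‖ * (c * ‖ls j z - l z‖)) atTop
          (𝓝 (∫ z : Fin n → ℝ, (0 : ℝ))) := by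
        refine tendsto_integral_of_dominated_convergence (fun z => ‖h z‖ * (c * (3 * R)))
          (fun j => ?_) (hh.norm.mul_const _) (fun j => Eventually.of_forall fun z => ?_)
          (Eventually.of_forall fun z => ?_)
        · exact hh.1.norm.mul
            (((ls j).measurable.sub hl).norm.const_mul c).aestronglyMeasurable
        · by_cases hz : h z = 0
          · simp [hz]
          · rw [Real.norm_of_nonneg (by positivity)]
            gcongr
            linarith [norm_sub_le (ls j z) (l z), hbd j z, hR z hz]
        · have := (tendsto_iff_norm_sub_tendsto_zero.1 (hlim z)).const_mul c
          simpa using this.const_mul ‖h z‖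
      simpa using this.const_mul K
    refine squeeze_zero (fun _ => norm_nonneg _) (fun j => ?_) hI
    rw [← map_sub, Real.norm_eq_abs]
    have hbd' : ∀ z, h z ≠ 0 → ‖ls j z‖ ≤ 2 * R := fun z hz => by linarith [hbd j z, hR z hz]
    have t1 := isTestFun_Iop hh (ls j).measurable hθ (2 * R) hbd'
    have t2 := isTestFun_Iop hh hl hθ R hR
    refine hf.2 _ (isTestFun_sub t1 t2) _ ?_
    intro i hi y
    rw [iteratedFDeriv_sub_apply, iteratedFDeriv_Iop hh (ls j).measurable hθ,
      iteratedFDeriv_Iop hh hl hθ]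
    rotate_left
    · exact (t1.1.of_le (by exact_mod_cast le_top)).contDiffAt
    · exact (t2.1.of_le (by exact_mod_cast le_top)).contDiffAt
    have hci := hθ.1.continuous_iteratedFDeriv (m := i) (by exact_mod_cast le_top)
    have hcs := hθ.2.iteratedFDeriv (𝕜 := ℝ) i
    rw [← integral_sub (integrable_smul_shift hh (ls j).measurable hci hcs y)
      (integrable_smul_shift hh hl hci hcs y), ← integral_mul_const]
    refine norm_integral_le_of_norm_le ?_ (Eventually.of_forall fun z => ?_)
    · refine Integrable.mul_const ?_ _
      refine (hh.norm.mul_const (c * (3 * R))).mono' (hh.1.norm.mul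
            (((ls j).measurable.sub hl).norm.const_mul c).aestronglyMeasurable)
            (Eventually.of_forall fun z => ?_)
      by_cases hz : h z = 0
      · simp [hz]
      · rw [Real.norm_of_nonneg (by positivity)]
        gcongr
        linarith [norm_sub_le (ls j z) (l z), hbd j z, hR z hz]
    · rw [← smul_sub, norm_smul, mul_assoc]
      by_cases hz : h z = 0
      · simp [hz]
      · gcongr
        refine (Dec_shift_sub hθ (Nat.cast_nonneg N) hs (ls j z) (l z) (3 * R) (2 * R)
          ?_ ?_ hi y)
        · linarith [norm_sub_le (ls j z) (l z), hbd j z, hR z hz]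
        · linarith [hR z hz]
  exact tendsto_nhds_unique hl2 (by simpa only [hsimp] using hl1)

theorem phiOf_test {n : ℕ} {φ₀ : (Fin n → ℝ) → ℝ} (h : IsTestFun n φ₀) :
    IsTestFun n (phiOf n φ₀) :=
  isTestFun_sub h (isTestFun_smul ((2 : ℝ)⁻¹ ^ n) (isTestFun_scale h (2 : ℝ)⁻¹ (by norm_num)))

theorem phiFam_test {n : ℕ} {φ₀ : (Fin n → ℝ) → ℝ} (h : IsTestFun n φ₀) (k : ℕ) :
    IsTestFun n (phiFam n φ₀ k) := by
  cases k with
  | zero => exact h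
  | succ k => exact isTestFun_smul _ (isTestFun_scale (phiOf_test h) _ (by positivity))

theorem isTestFun_reflect {n : ℕ} {θ : (Fin n → ℝ) → ℝ} (h : IsTestFun n θ) :
    IsTestFun n (fun y => θ (-y)) := by
  simpa using isTestFun_scale h (-1) (by norm_num)

theorem distConv_eq {n : ℕ} (f : Dstrb n) (η : (Fin n → ℝ) → ℝ) (x : Fin n → ℝ) :
    distConv n f η x = f (fun y => (fun w => η (-w)) (y + -x)) := by
  unfold distConv; congr 1; funext y; simp [sub_eq_add_neg]

theorem isTestFun_conv {n : ℕ} {θ : (Fin n → ℝ) → ℝ} (h : IsTestFun n θ) (x : Fin n → ℝ) :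
    IsTestFun n (fun y => θ (x - y)) := by
  have := isTestFun_shift (isTestFun_reflect h) (-x)
  simpa [sub_eq_add_neg, add_comm] using this

theorem continuous_distConv {n : ℕ} {f : Dstrb n} {N : ℕ} {K : ℝ} (hf : Bd f N K)
    {η : (Fin n → ℝ) → ℝ} (hη : IsTestFun n η) : Continuous (distConv n f η) := by
  have := (continuous_shift hf (isTestFun_reflect hη)).comp continuous_neg
  exact this.congr fun x => (distConv_eq f η x).symm

theorem Dec_scaled {n : ℕ} {ψ : (Fin n → ℝ) → ℝ} (hψ : IsTestFun n ψ) {N : ℕ} {s : ℝ}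
    (hs : Dec N N ψ s) (L : ℝ) (hL : 1 ≤ L) (x : Fin n → ℝ) :
    Dec N N (fun y => L ^ n * ψ (L • (x - y))) (L ^ (n + N) * s * Real.exp (N * ‖x‖)) := by
  intro i hi y
  have hL0 : 0 < L := by linarith
  set g : (Fin n → ℝ) →L[ℝ] (Fin n → ℝ) := (-L) • ContinuousLinearMap.id ℝ _ with hg
  have hgn : ‖g‖ ≤ L := by
    refine ContinuousLinearMap.opNorm_le_bound _ hL0.le fun z => ?_
    simp [hg, norm_smul, abs_of_pos hL0]
  have e1 : (fun y => L ^ n * ψ (L • (x - y))) = fun y => (L ^ n • (ψ ∘ g)) (y + -x) := by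
    funext y
    simp only [Pi.smul_apply, Function.comp_apply, hg, smul_eq_mul, smul_apply,
      ContinuousLinearMap.id_apply]
    congr 2
    module
  have hi' : ((i : ℕ∞) : WithTop ℕ∞) ≤ ((⊤ : ℕ∞) : WithTop ℕ∞) := by exact_mod_cast le_top
  rw [e1, iteratedFDeriv_comp_add_right, iteratedFDeriv_const_smul_apply
    ((hψ.1.comp g.contDiff).of_le hi').contDiffAt, g.iteratedFDeriv_comp_right hψ.1 _ hi']
  rw [norm_smul, Real.norm_of_nonneg (by positivity)]
  have h2 := (iteratedFDeriv ℝ i ψ (g (y + -x))).norm_compContinuousLinearMap_le (fun _ => g)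
  have h3 : ∏ _j : Fin i, ‖g‖ ≤ L ^ N := by
    rw [Finset.prod_const, Finset.card_univ, Fintype.card_fin]
    exact (pow_le_pow_left₀ (norm_nonneg _) hgn i).trans (pow_le_pow_right₀ hL hi)
  have h4 : Real.exp (-(N * ‖g (y + -x)‖)) ≤ Real.exp (N * ‖x‖) * Real.exp (-(N * ‖y‖)) := by
    rw [← Real.exp_add]
    gcongr
    have : ‖g (y + -x)‖ = L * ‖y + -x‖ := by
      rw [hg, smul_apply, norm_smul, norm_neg, Real.norm_of_nonneg hL0.le]; rfl
    rw [this]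
    have h5 := norm_sub_norm_le y x
    rw [sub_eq_add_neg y x] at h5
    have h6 : ‖y + -x‖ ≤ L * ‖y + -x‖ := le_mul_of_one_le_left (norm_nonneg _) hL
    have : (N : ℝ) * (‖y‖ - ‖x‖) ≤ N * (L * ‖y + -x‖) := by gcongr; linarith
    linarith
  have hs0 := hs.nonneg
  calc _ ≤ L ^ n * ((s * Real.exp (-(N * ‖g (y + -x)‖))) * L ^ N) := by
        gcongr
        exact h2.trans (mul_le_mul (hs i hi _) h3 (by positivity) (by positivity))
    _ ≤ L ^ n * ((s * (Real.exp (N * ‖x‖) * Real.exp (-(N * ‖y‖)))) * L ^ N) := by gcongr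
    _ = _ := by ring

/-- growth of the local means -/
theorem growth {n : ℕ} {φ₀ : (Fin n → ℝ) → ℝ} (h : IsTestFun n φ₀) (N : ℕ) :
    ∃ c : ℝ, 0 ≤ c ∧ ∀ (f : Dstrb n) (K : ℝ), Bd f N K → ∀ k x,
      |distConv n f (phiFam n φ₀ k) x| ≤ K * c * 2 ^ (k * (n + N)) * Real.exp (N * ‖x‖) := by
  obtain ⟨s₀, hs₀⟩ := exists_Dec h N N
  obtain ⟨s₁, hs₁⟩ := exists_Dec (phiOf_test h) N N
  refine ⟨max s₀ s₁, hs₀.nonneg.trans (le_max_left _ _), fun f K hf k x => ?_⟩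
  have hD : Dec N N (fun y => phiFam n φ₀ k (x - y))
      ((2 ^ k) ^ (n + N) * max s₀ s₁ * Real.exp (N * ‖x‖)) := by
    cases k with
    | zero =>
      have := Dec_scaled h hs₀ 1 le_rfl x
      simp only [one_pow, one_mul, one_smul] at this
      refine this.mono le_rfl le_rfl ?_
      simp only [pow_zero, one_pow, one_mul]
      gcongr
      exact le_max_left _ _
    | succ k =>
      have := Dec_scaled (phiOf_test h) hs₁ (2 ^ (k + 1)) (one_le_pow₀ (by norm_num)) x
      rw [← pow_mul] at this
      refine this.mono le_rfl le_rfl ?_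
      gcongr
      exact le_max_right _ _
  refine (hf.2 _ (isTestFun_conv (phiFam_test h k) x) _ hD).trans (le_of_eq ?_)
  rw [pow_mul]; ring


/-- the submodule of test functions -/
def TF (n : ℕ) : Submodule ℝ ((Fin n → ℝ) → ℝ) where
  carrier := {θ | IsTestFun n θ}
  add_mem' := isTestFun_add
  zero_mem' := ⟨contDiff_const, HasCompactSupport.zero⟩
  smul_mem' := fun c _ h => isTestFun_smul c h

theorem isTestFun_integrable {n : ℕ} {θ : (Fin n → ℝ) → ℝ} (h : IsTestFun n θ) : Integrable θ :=
  h.1.continuous.integrable_of_hasCompactSupport h.2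

theorem isTestFun_avg {n : ℕ} {φ₀ : (Fin n → ℝ) → ℝ} (hφ : IsTestFun n φ₀) (ε : ℝ)
    {θ : (Fin n → ℝ) → ℝ} (h : IsTestFun n θ) : IsTestFun n (Iop φ₀ (fun z => ε • z) θ) := by
  obtain ⟨R, hR0, hR⟩ := isTestFun_bound hφ
  refine isTestFun_Iop (l := fun z => ε • z) (isTestFun_integrable hφ) (measurable_id.const_smul ε)
    h (|ε| * R) ?_
  intro z hz
  rw [norm_smul, Real.norm_eq_abs]
  gcongr
  by_contra hcon
  exact hz (hR z (not_le.1 hcon))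

theorem avg_integrable {n : ℕ} {φ₀ : (Fin n → ℝ) → ℝ} (hφ : IsTestFun n φ₀) (ε : ℝ)
    {θ : (Fin n → ℝ) → ℝ} (h : IsTestFun n θ) (y : Fin n → ℝ) :
    Integrable (fun z => φ₀ z * θ (y + ε • z)) :=
  integrable_smul_shift (isTestFun_integrable hφ) (measurable_id.const_smul ε) h.1.continuous h.2 y

/-- averaging operator -/
def Avg {n : ℕ} {φ₀ : (Fin n → ℝ) → ℝ} (hφ : IsTestFun n φ₀) (ε : ℝ) : Module.End ℝ (TF n) where
  toFun θ := ⟨Iop φ₀ (fun z => ε • z) θ, isTestFun_avg hφ ε θ.2⟩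
  map_add' θ θ' := by
    ext y
    simp only [Iop, Submodule.coe_add, Pi.add_apply, mul_add]
    exact integral_add (avg_integrable hφ ε θ.2 y) (avg_integrable hφ ε θ'.2 y)
  map_smul' c θ := by
    ext y
    simp only [Iop, Submodule.coe_smul, Pi.smul_apply, smul_eq_mul, RingHom.id_apply]
    rw [← integral_const_mul]
    congr 1; funext z; ring

theorem Avg_commute {n : ℕ} {φ₀ : (Fin n → ℝ) → ℝ} (hφ : IsTestFun n φ₀) (ε ε' : ℝ) :
    Commute (Avg hφ ε) (Avg hφ ε') := by
  refine LinearMap.ext fun θ => Subtype.ext (funext fun y => ?_)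
  change ∫ z, φ₀ z * ∫ w, φ₀ w * θ.1 (y + ε • z + ε' • w) =
    ∫ w, φ₀ w * ∫ z, φ₀ z * θ.1 (y + ε' • w + ε • z)
  simp_rw [← integral_const_mul]
  rw [integral_integral_swap]
  · congr 1; funext w; congr 1; funext z
    rw [show y + ε • z + ε' • w = y + ε' • w + ε • z by abel]; ring
  · have hi := isTestFun_integrable hφ
    obtain ⟨C, hC⟩ := θ.2.2.exists_bound_of_continuous θ.2.1.continuous
    have hc : Continuous θ.1 := θ.2.1.continuous
    have hc' : Continuous φ₀ := hφ.1.continuous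
    refine ((hi.mul_prod hi).norm.mul_const C).mono' ?_ (Eventually.of_forall fun q => ?_)
    · refine Continuous.aestronglyMeasurable ?_
      simp only [Function.uncurry_def]
      fun_prop
    · simp only [Function.uncurry_def, ← mul_assoc]
      rw [norm_mul]
      gcongr
      exact hC _

theorem Dec_one_sub_avg {n : ℕ} {φ₀ : (Fin n → ℝ) → ℝ} (hφ : IsTestFun n φ₀)
    (hint : (∫ x, φ₀ x) = 1) (a : ℝ) (ha : 0 ≤ a) :
    ∃ C : ℝ, 1 ≤ C ∧ ∀ ε : ℝ, 0 ≤ ε → ε ≤ 1 → ∀ (m : ℕ) (θ : TF n) (s : ℝ), Dec a (m + 1) θ.1 s →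
      Dec a m ((1 - Avg hφ ε) θ).1 (C * ε * s) := by
  obtain ⟨R, hR0, hR⟩ := isTestFun_bound hφ
  have hi := isTestFun_integrable hφ
  set C₀ := (∫ z, ‖φ₀ z‖) * (Real.exp (a * R) * R) with hC₀
  refine ⟨max 1 C₀, le_max_left _ _, fun ε hε hε1 m θ s hs => ?_⟩
  have hs0 := hs.nonneg
  suffices H : Dec a m ((1 - Avg hφ ε) θ).1 (C₀ * ε * s) by
    refine H.mono le_rfl le_rfl ?_
    gcongr
    exact le_max_right _ _
  intro i hi' y
  have e1 : ((1 - Avg hφ ε) θ).1 = θ.1 - Iop φ₀ (fun z => ε • z) θ.1 := rfl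
  have hl : Measurable (fun z : Fin n → ℝ => ε • z) := measurable_id.const_smul ε
  have t2 := isTestFun_avg hφ ε θ.2
  rw [e1, iteratedFDeriv_sub_apply, iteratedFDeriv_Iop hi hl θ.2]
  rotate_left
  · exact (θ.2.1.of_le (by exact_mod_cast le_top)).contDiffAt
  · exact (t2.1.of_le (by exact_mod_cast le_top)).contDiffAt
  have hci := θ.2.1.continuous_iteratedFDeriv (m := i) (by exact_mod_cast le_top)
  have hcs := θ.2.2.iteratedFDeriv (𝕜 := ℝ) i
  have e2 : iteratedFDeriv ℝ i θ.1 y = ∫ z, φ₀ z • iteratedFDeriv ℝ i θ.1 y := by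
    rw [integral_smul_const, hint, one_smul]
  simp only []
  rw [e2, ← integral_sub (hi.smul_const _) (integrable_smul_shift hi hl hci hcs y)]
  have e3 : C₀ * ε * s * Real.exp (-(a * ‖y‖)) =
      ∫ z, ‖φ₀ z‖ * (Real.exp (a * R) * R * ε * s * Real.exp (-(a * ‖y‖))) := by
    rw [integral_mul_const, hC₀]; ring
  rw [e3]
  refine norm_integral_le_of_norm_le (hi.norm.mul_const _) (Eventually.of_forall fun z => ?_)
  rw [← smul_sub, norm_smul]
  by_cases hz : φ₀ z = 0
  · simp [hz]
  have hzR : ‖z‖ ≤ R := by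
    by_contra hcon
    exact hz (hR z (not_le.1 hcon))
  gcongr
  have hεz : ‖ε • z‖ ≤ ε * R := by
    rw [norm_smul, Real.norm_of_nonneg hε]; gcongr
  have hεz' : ‖ε • z‖ ≤ R := hεz.trans (by nlinarith)
  rw [norm_sub_rev]
  refine (norm_iterated_sub_le θ.2.1 ha hs hi' y (ε • z) R hεz').trans ?_
  calc _ ≤ s * Real.exp (a * R) * Real.exp (-(a * ‖y‖)) * (ε * R) := by gcongr
    _ = _ := by ring

/-- shifted family of averaging operators -/
def Aop {n : ℕ} {φ₀ : (Fin n → ℝ) → ℝ} (hφ : IsTestFun n φ₀) : ℕ → Module.End ℝ (TF n)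
  | 0 => 0
  | k + 1 => Avg hφ ((2 : ℝ) ^ k)⁻¹

/-- one minus average -/
def Xop {n : ℕ} {φ₀ : (Fin n → ℝ) → ℝ} (hφ : IsTestFun n φ₀) (k : ℕ) : Module.End ℝ (TF n) :=
  1 - Aop hφ k

theorem one_sub_commute_aux {R : Type*} [Ring R] (a b : R) (h : Commute a b) :
    Commute (1 - a) (1 - b) :=
  (Commute.one_left _).sub_left ((Commute.one_right _).sub_right h)

theorem reproducing_aux {R : Type*} [Ring R] (A : ℕ → R) (h0 : A 0 = 0)
    (h : ∀ k j, Commute (1 - A k) (1 - A j)) (M J : ℕ) :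
    1 = (1 - A J) ^ (M + 1) + ∑ k ∈ Finset.range J, (A (k + 1) - A k) *
      ∑ i ∈ Finset.range (M + 1), (1 - A k) ^ i * (1 - A (k + 1)) ^ (M + 1 - 1 - i) := by
  have h1 : ∀ k, (A (k + 1) - A k) *
      ∑ i ∈ Finset.range (M + 1), (1 - A k) ^ i * (1 - A (k + 1)) ^ (M + 1 - 1 - i) =
      (1 - A k) ^ (M + 1) - (1 - A (k + 1)) ^ (M + 1) := by
    intro k
    rw [← (h k (k + 1)).mul_geom_sum₂]
    congr 1
    abel
  simp_rw [h1]
  rw [Finset.sum_range_sub' (fun k => (1 - A k) ^ (M + 1))]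
  simp [h0]

theorem Xop_commute {n : ℕ} {φ₀ : (Fin n → ℝ) → ℝ} (hφ : IsTestFun n φ₀) (k j : ℕ) :
    Commute (Xop hφ k) (Xop hφ j) := by
  have : Commute (Aop hφ k) (Aop hφ j) := by
    cases k with
    | zero => exact Commute.zero_left _
    | succ k =>
      cases j with
      | zero => exact Commute.zero_right _
      | succ j => exact Avg_commute hφ _ _
  exact one_sub_commute_aux (R := Module.End ℝ (TF n)) (Aop hφ k) (Aop hφ j) this

/-- the dual kernels -/
def Qop {n : ℕ} {φ₀ : (Fin n → ℝ) → ℝ} (hφ : IsTestFun n φ₀) (M k : ℕ) : Module.End ℝ (TF n) :=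
  ∑ i ∈ Finset.range (M + 1), Xop hφ k ^ i * Xop hφ (k + 1) ^ (M + 1 - 1 - i)

theorem reproducing {n : ℕ} {φ₀ : (Fin n → ℝ) → ℝ} (hφ : IsTestFun n φ₀) (M J : ℕ) :
    (1 : Module.End ℝ (TF n)) = Xop hφ J ^ (M + 1) +
      ∑ k ∈ Finset.range J, (Aop hφ (k + 1) - Aop hφ k) * Qop hφ M k := by
  exact reproducing_aux (Aop hφ) rfl (Xop_commute hφ) M J

theorem Dec_Xop {n : ℕ} {φ₀ : (Fin n → ℝ) → ℝ} (hφ : IsTestFun n φ₀)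
    (hint : (∫ x, φ₀ x) = 1) (a : ℝ) (ha : 0 ≤ a) :
    ∃ C : ℝ, 1 ≤ C ∧ ∀ (k j m : ℕ) (θ : TF n) (s : ℝ), Dec a (m + j) θ.1 s →
      Dec a m ((Xop hφ k ^ j) θ).1 ((C * (2 ^ k)⁻¹) ^ j * s) := by
  obtain ⟨C, hC1, hC⟩ := Dec_one_sub_avg hφ hint a ha
  have key : ∀ (k m : ℕ) (θ : TF n) (s : ℝ), Dec a (m + 1) θ.1 s →
      Dec a m (Xop hφ k θ).1 ((2 * C * (2 ^ k)⁻¹) * s) := by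
    intro k m θ s hs
    have hs0 := hs.nonneg
    cases k with
    | zero =>
      have : Xop hφ 0 θ = θ := by simp [Xop, Aop]
      rw [this]
      refine hs.mono le_rfl (by omega) ?_
      simp only [pow_zero, inv_one, mul_one]
      nlinarith
    | succ k =>
      have h2 : (0 : ℝ) < 2 ^ k := by positivity
      refine (hC (2 ^ k)⁻¹ (by positivity) (inv_le_one_of_one_le₀ (one_le_pow₀ (by norm_num)))
        m θ s hs).mono le_rfl le_rfl (le_of_eq ?_)
      rw [pow_succ]; field_simp
  refine ⟨2 * C, by linarith, fun k j => ?_⟩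
  induction j with
  | zero => intro m θ s hs; simpa using hs
  | succ j ih =>
    intro m θ s hs
    have h1 := ih (m + 1) θ s (by rwa [add_assoc, add_comm 1 j])
    have h2 := key k m _ _ h1
    rw [← mul_assoc, ← pow_succ'] at h2
    rw [pow_succ']
    exact h2

theorem Dec_zero_fun {n : ℕ} (a : ℝ) (m : ℕ) : Dec a m (0 : (Fin n → ℝ) → ℝ) 0 := by
  intro i hi x
  simp

theorem Dec_sum {n : ℕ} {a : ℝ} {m : ℕ} {ι : Type*} (S : Finset ι) (g : ι → TF n) (s : ι → ℝ)
    (h : ∀ i ∈ S, Dec a m (g i).1 (s i)) : Dec a m (∑ i ∈ S, g i).1 (∑ i ∈ S, s i) := by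
  classical
  induction S using Finset.induction_on with
  | empty => simpa using Dec_zero_fun a m
  | insert i S hi ih =>
    rw [Finset.sum_insert hi, Finset.sum_insert hi]
    exact (h i (by simp)).add (g i).2.1 (∑ i ∈ S, g i).2.1 (ih fun j hj => h j (by simp [hj]))

theorem Dec_Qop {n : ℕ} {φ₀ : (Fin n → ℝ) → ℝ} (hφ : IsTestFun n φ₀)
    (hint : (∫ x, φ₀ x) = 1) (a : ℝ) (ha : 0 ≤ a) (M : ℕ) :
    ∃ C : ℝ, 0 ≤ C ∧ ∀ (k : ℕ) (θ : TF n) (s : ℝ), Dec a M θ.1 s →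
      Dec a 0 (Qop hφ M k θ).1 (C * ((2 ^ k)⁻¹) ^ M * s) := by
  obtain ⟨C, hC1, hC⟩ := Dec_Xop hφ hint a ha
  refine ⟨(M + 1) * C ^ M, by positivity, fun k θ s hs => ?_⟩
  have hs0 := hs.nonneg
  have e : Qop hφ M k θ = ∑ i ∈ Finset.range (M + 1),
      (Xop hφ k ^ i) ((Xop hφ (k + 1) ^ (M - i)) θ) := by
    simp [Qop, LinearMap.sum_apply]
  rw [e]
  have := Dec_sum (a := a) (m := 0) (Finset.range (M + 1))
    (fun i => (Xop hφ k ^ i) ((Xop hφ (k + 1) ^ (M - i)) θ))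
    (fun i => (C * (2 ^ k)⁻¹) ^ M * s) ?_
  · refine this.mono le_rfl le_rfl (le_of_eq ?_)
    rw [Finset.sum_const, Finset.card_range, nsmul_eq_mul, mul_pow]
    push_cast; ring
  · intro i hi
    rw [Finset.mem_range] at hi
    have h1 := hC (k + 1) (M - i) i θ s (hs.mono le_rfl (by omega) le_rfl)
    have h2 := hC k i 0 _ _ (by rwa [zero_add])
    refine h2.mono le_rfl le_rfl ?_
    have h3 : (C * (2 ^ (k + 1))⁻¹) ^ (M - i) ≤ (C * (2 ^ k)⁻¹) ^ (M - i) := by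
      gcongr
      · norm_num
      · omega
    calc _ ≤ (C * (2 ^ k)⁻¹) ^ i * ((C * (2 ^ k)⁻¹) ^ (M - i) * s) := by gcongr
      _ = _ := by rw [← mul_assoc, ← pow_add]; congr 2; omega

theorem avg_eq {n : ℕ} (φ₀ θ : (Fin n → ℝ) → ℝ) (k : ℕ) (y : Fin n → ℝ) :
    Iop φ₀ (fun z => ((2 : ℝ) ^ k)⁻¹ • z) θ y =
      ∫ x, θ x * ((2 : ℝ) ^ (k * n) * φ₀ ((2 : ℝ) ^ k • (x - y))) := by
  have h1 : ∫ x, θ x * ((2 : ℝ) ^ (k * n) * φ₀ ((2 : ℝ) ^ k • (x - y))) =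
      ∫ x, θ (x + y) * ((2 : ℝ) ^ (k * n) * φ₀ ((2 : ℝ) ^ k • x)) := by
    rw [← integral_add_right_eq_self (μ := volume) _ y]
    simp
  have h2 : (2 : ℝ) ^ k ≠ 0 := by positivity
  have h3 := Measure.integral_comp_smul (volume : Measure (Fin n → ℝ))
    (fun z => φ₀ z * θ (y + ((2 : ℝ) ^ k)⁻¹ • z)) ((2 : ℝ) ^ k)
  simp only [smul_smul, inv_mul_cancel₀ h2, one_smul, Module.finrank_fintype_fun_eq_card,
    Fintype.card_fin] at h3
  rw [h1, Iop]
  have h4 : ∀ x : Fin n → ℝ, θ (x + y) * ((2 : ℝ) ^ (k * n) * φ₀ ((2 : ℝ) ^ k • x)) =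
    (2 : ℝ) ^ (k * n) * (φ₀ ((2 : ℝ) ^ k • x) * θ (y + x)) := by
      intro x; rw [add_comm x y]; ring
  simp_rw [h4]
  rw [integral_const_mul, h3, abs_of_pos (by positivity), pow_mul, smul_eq_mul, ← mul_assoc,
    mul_inv_cancel₀ (by positivity), one_mul]

theorem Bop_eq {n : ℕ} {φ₀ : (Fin n → ℝ) → ℝ} (hφ : IsTestFun n φ₀) (k : ℕ) (θ : TF n) :
    ((Aop hφ (k + 1) - Aop hφ k) θ).1 =
      Iop θ.1 (fun x => -x) (fun w => phiFam n φ₀ k (-w)) := by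
  funext y
  cases k with
  | zero =>
    have : ((Aop hφ (0 + 1) - Aop hφ 0) θ).1 y = Iop φ₀ (fun z => ((2 : ℝ) ^ 0)⁻¹ • z) θ.1 y := by
      change (Avg hφ ((2 : ℝ) ^ 0)⁻¹ θ).1 y - 0 = _
      rw [sub_zero]; rfl
    rw [this, avg_eq]
    simp [Iop, phiFam, sub_eq_add_neg]
  | succ k =>
    have : ((Aop hφ (k + 1 + 1) - Aop hφ (k + 1)) θ).1 y =
      Iop φ₀ (fun z => ((2 : ℝ) ^ (k + 1))⁻¹ • z) θ.1 y - Iop φ₀ (fun z => ((2 : ℝ) ^ k)⁻¹ • z) θ.1 y := by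
      rfl
    rw [this, avg_eq, avg_eq]
    have hint : ∀ k : ℕ, Integrable
        fun x => θ.1 x * ((2 : ℝ) ^ (k * n) * φ₀ ((2 : ℝ) ^ k • (x - y))) := by
      intro k
      refine Continuous.integrable_of_hasCompactSupport ?_ (θ.2.2.mul_right)
      have hc : Continuous θ.1 := θ.2.1.continuous
      have hc' : Continuous φ₀ := hφ.1.continuous
      fun_prop
    rw [← integral_sub (hint _) (hint _), Iop]
    congr 1; funext x
    simp only [phiFam, phiOf]
    rw [show -(y + -x) = x - y by abel, smul_smul,
      show (2 : ℝ)⁻¹ * 2 ^ (k + 1) = 2 ^ k by rw [pow_succ]; ring]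
    have : (2 : ℝ) ^ ((k + 1) * n) * (2 : ℝ)⁻¹ ^ n = 2 ^ (k * n) := by
      rw [add_mul, one_mul, pow_add, mul_assoc, ← mul_pow]; norm_num
    rw [← this]; ring

theorem f_Bop {n : ℕ} {φ₀ : (Fin n → ℝ) → ℝ} (hφ : IsTestFun n φ₀) {f : Dstrb n} {N : ℕ} {K : ℝ}
    (hf : Bd f N K) (k : ℕ) (θ : TF n) :
    f ((Aop hφ (k + 1) - Aop hφ k) θ).1 = ∫ x, θ.1 x * distConv n f (phiFam n φ₀ k) x := by
  rw [Bop_eq]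
  obtain ⟨R, hR0, hR⟩ := isTestFun_bound θ.2
  rw [exchange hf (isTestFun_reflect (phiFam_test hφ k)) (isTestFun_integrable θ.2) measurable_neg
    R hR0]
  · congr 1; funext x; rw [distConv_eq]
  · intro z hz
    rw [norm_neg]
    by_contra hcon
    exact hz (hR z (not_le.1 hcon))


theorem tsum_pi_prod (a : ℤ → ℝ≥0∞) (n : ℕ) :
    ∑' m : Fin n → ℤ, ∏ i, a (m i) = (∑' z, a z) ^ n := by
  induction n with
  | zero => simp
  | succ n ih =>
    rw [← (Fin.consEquiv (fun _ : Fin (n + 1) => ℤ)).tsum_eq, ENNReal.tsum_prod']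
    simp only [Fin.consEquiv_apply, Fin.prod_univ_succ, Fin.cons_zero, Fin.cons_succ]
    simp_rw [ENNReal.tsum_mul_left, ih, ENNReal.tsum_mul_right]
    rw [pow_succ']

theorem tsum_exp_int : ∑' z : ℤ, ENNReal.ofReal (Real.exp (-(z.natAbs : ℝ))) ≠ ∞ := by
  have h : Summable (fun z : ℤ => Real.exp (-(z.natAbs : ℝ))) := by
    have h1 : Summable (fun k : ℕ => Real.exp (-(k : ℝ))) := Real.summable_exp_neg_nat
    refine Summable.of_nat_of_neg ?_ ?_
    · simpa using h1
    · simpa using h1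
  exact h.tsum_ofReal_ne_top

theorem tkm_chain {n : ℕ} {p : ℝ≥0∞} {t : ℕ → (Fin n → ℝ) → ℝ} {α₃ : ℝ}
    (h : ∀ (k : ℕ) (m m' : Fin n → ℤ), (∀ i, |m i - m' i| ≤ 1) →
    tkm n p t k m ≤ ENNReal.ofReal (2 ^ α₃) * tkm n p t k m') (J : ℕ) :
    ∀ m : Fin n → ℤ, (∀ i, |m i| ≤ J) →
      tkm n p t 0 0 ≤ ENNReal.ofReal (2 ^ α₃) ^ J * tkm n p t 0 m := by
  induction J with
  | zero =>
    intro m hm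
    have : m = 0 := by
      funext i
      have := hm i
      simpa using this
    simp [this]
  | succ J ih =>
    intro m hm
    set m' : Fin n → ℤ := fun i => m i - (m i).sign with hm'
    have h1 : ∀ i, |m' i| ≤ J := by
      intro i
      have := hm i
      simp only [hm']
      push_cast at this
      rcases lt_trichotomy (m i) 0 with hi | hi | hi
      · rw [Int.sign_eq_neg_one_of_neg hi]
        rw [abs_le] at this ⊢
        omega
      · simp [hi]
      · rw [Int.sign_eq_one_of_pos hi]
        rw [abs_le] at this ⊢
        omega
    have h2 : ∀ i, |m' i - m i| ≤ 1 := by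
      intro i
      simp only [hm']
      rcases lt_trichotomy (m i) 0 with hi | hi | hi
      · rw [Int.sign_eq_neg_one_of_neg hi]; simp
      · simp [hi]
      · rw [Int.sign_eq_one_of_pos hi]; simp
    refine (ih m' h1).trans ?_
    rw [pow_succ, mul_assoc]
    gcongr
    exact h 0 m' m h2

theorem inv_weight_bound {n : ℕ} {p σ₁ σ₂ : ℝ≥0∞} {α₁ α₂ α₃ : ℝ}
    {t : ℕ → (Fin n → ℝ) → ℝ} (ht : MemX n p σ₁ σ₂ α₁ α₂ α₃ t) :
    ∃ D : ℝ, 0 < D ∧ ∀ (k J : ℕ) (m : Fin n → ℤ), (∀ i, |m i| ≤ J) →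
      eLpNorm (fun x => (t k x)⁻¹) σ₁ (volume.restrict (dyadicCube n 0 m)) ≤
        ENNReal.ofReal (D * 2 ^ (|α₁| * k) * (2 ^ α₃) ^ J) := by
  obtain ⟨⟨_, _, hfin⟩, ⟨C₁, hC₁, h1⟩, _, hpos, hstep⟩ := ht
  have h00 := hpos 0 0
  have h00' := hfin 0 0
  have hτ : 0 < (tkm n p t 0 0).toReal := ENNReal.toReal_pos h00.ne' h00'.ne
  refine ⟨C₁ / (tkm n p t 0 0).toReal, by positivity, fun k J m hm => ?_⟩
  have h2 := h1 0 k (Nat.zero_le _) m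
  simp only [zero_mul, pow_zero, ENNReal.one_rpow, one_mul, Nat.cast_zero, zero_sub] at h2
  have h3 := tkm_chain hstep J m hm
  set e := eLpNorm (fun x => (t k x)⁻¹) σ₁ (volume.restrict (dyadicCube n 0 m))
  have h4 : tkm n p t 0 0 * e ≤ ENNReal.ofReal (C₁ * 2 ^ (|α₁| * k) * (2 ^ α₃) ^ J) := by
    calc _ ≤ ENNReal.ofReal (2 ^ α₃) ^ J * tkm n p t 0 m * e := by gcongr
      _ = ENNReal.ofReal (2 ^ α₃) ^ J * (tkm n p t 0 m * e) := by rw [mul_assoc]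
      _ ≤ ENNReal.ofReal (2 ^ α₃) ^ J * ENNReal.ofReal (C₁ * 2 ^ (|α₁| * k)) := by
          gcongr
          refine h2.trans (ENNReal.ofReal_le_ofReal ?_)
          apply mul_le_mul_of_nonneg_left _ hC₁.le
          apply Real.rpow_le_rpow_of_exponent_le (by norm_num)
          nlinarith [neg_abs_le α₁, (Nat.cast_nonneg k : (0:ℝ) ≤ k)]
      _ = _ := by
          rw [← ENNReal.ofReal_pow (by positivity), ← ENNReal.ofReal_mul (by positivity)]
          congr 1; ring
  have h5 : e ≤ ENNReal.ofReal (C₁ * 2 ^ (|α₁| * k) * (2 ^ α₃) ^ J) / tkm n p t 0 0 := by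
    rw [ENNReal.le_div_iff_mul_le (Or.inl h00.ne') (Or.inl h00'.ne), mul_comm]
    exact h4
  refine h5.trans (le_of_eq ?_)
  conv_lhs => rw [← ENNReal.ofReal_toReal h00'.ne]
  rw [← ENNReal.ofReal_div_of_pos hτ]
  congr 1; ring

theorem cube_eq {n : ℕ} (m : Fin n → ℤ) :
    dyadicCube n 0 m = Set.Icc (fun i => (m i : ℝ)) (fun i => (m i : ℝ) + 1) := by
  ext x
  simp [dyadicCube, Pi.le_def, forall_and]

theorem cube_volume {n : ℕ} (m : Fin n → ℤ) : volume (dyadicCube n 0 m) = 1 := by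
  rw [cube_eq, Real.volume_Icc_pi]
  simp

theorem cube_cover (n : ℕ) : (⋃ m : Fin n → ℤ, dyadicCube n 0 m) = Set.univ := by
  rw [Set.eq_univ_iff_forall]
  intro x
  rw [Set.mem_iUnion]
  refine ⟨fun i => ⌊x i⌋, ?_⟩
  rw [cube_eq]
  exact ⟨fun i => Int.floor_le _, fun i => (Int.lt_floor_add_one _).le⟩

theorem cube_eLpNorm {n : ℕ} {p σ₁ : ℝ≥0∞} {r : ℝ} (hr0 : 0 < r)
    (hr : ENNReal.ofReal r ≤ (σ₁⁻¹ + p⁻¹)⁻¹) {w : (Fin n → ℝ) → ℝ} (hw : Measurable w)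
    (hwpos : ∀ᵐ x : Fin n → ℝ, 0 < w x) {u : (Fin n → ℝ) → ℝ} (hu : Measurable u) (m : Fin n → ℤ) :
    ∫⁻ x in dyadicCube n 0 m, ENNReal.ofReal (|u x| ^ r) ≤
      (eLpNorm (fun x => (w x)⁻¹) σ₁ (volume.restrict (dyadicCube n 0 m)) *
        eLpNorm (fun x => w x * u x) p volume) ^ r := by
  set μ := volume.restrict (dyadicCube n 0 m) with hμ
  have : IsProbabilityMeasure μ := ⟨by rw [hμ, Measure.restrict_apply_univ, cube_volume]⟩
  have e1 : ∫⁻ x, ENNReal.ofReal (|u x| ^ r) ∂μ = eLpNorm u (ENNReal.ofReal r) μ ^ r := by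
    rw [eLpNorm_eq_eLpNorm' (by simpa using hr0) ENNReal.ofReal_ne_top, ENNReal.toReal_ofReal hr0.le,
      ← lintegral_rpow_enorm_eq_rpow_eLpNorm' hr0]
    congr 1; funext x
    rw [← ENNReal.ofReal_rpow_of_nonneg (abs_nonneg _) hr0.le, Real.enorm_eq_ofReal_abs]
  rw [e1]
  gcongr
  calc eLpNorm u (ENNReal.ofReal r) μ ≤ eLpNorm u (σ₁⁻¹ + p⁻¹)⁻¹ μ :=
        eLpNorm_le_eLpNorm_of_exponent_le hr hu.aestronglyMeasurable
    _ = eLpNorm ((fun x => (w x)⁻¹) • (fun x => w x * u x)) (σ₁⁻¹ + p⁻¹)⁻¹ μ := by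
        refine eLpNorm_congr_ae ?_
        filter_upwards [ae_restrict_of_ae hwpos] with x hx
        simp only [Pi.smul_apply', smul_eq_mul]
        field_simp
    _ ≤ eLpNorm (fun x => (w x)⁻¹) σ₁ μ * eLpNorm (fun x => w x * u x) p μ := by
        have : ENNReal.HolderTriple σ₁ p (σ₁⁻¹ + p⁻¹)⁻¹ := ⟨by rw [inv_inv]⟩
        exact eLpNorm_smul_le_mul_eLpNorm (hw.mul hu).aestronglyMeasurable
          hw.inv.aestronglyMeasurable
    _ ≤ _ := by
        exact mul_le_mul' le_rfl (eLpNorm_mono_measure (fun x => w x * u x) Measure.restrict_le_self)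

theorem weighted_int {n : ℕ} {p σ₁ σ₂ : ℝ≥0∞} {α₁ α₂ α₃ : ℝ} (hα₃ : 0 ≤ α₃)
    {t : ℕ → (Fin n → ℝ) → ℝ} (ht : MemX n p σ₁ σ₂ α₁ α₂ α₃ t) {r : ℝ} (hr0 : 0 < r) (hr1 : r ≤ 1)
    (hr : ENNReal.ofReal r ≤ (σ₁⁻¹ + p⁻¹)⁻¹) :
    ∃ D : ℝ, 0 ≤ D ∧ ∀ (k : ℕ) (u : (Fin n → ℝ) → ℝ), Measurable u →
      ∫⁻ x, ENNReal.ofReal (|u x| ^ r * Real.exp (-(n * (α₃ + 1) * ‖x‖))) ≤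
        ENNReal.ofReal (D * 2 ^ (|α₁| * k)) * eLpNorm (fun x => t k x * u x) p volume ^ r := by
  obtain ⟨D, hD, hDb⟩ := inv_weight_bound ht
  set S := ∑' z : ℤ, ENNReal.ofReal (Real.exp (-(z.natAbs : ℝ))) with hS
  set X := Real.exp ((α₃ + 1) * n) * D ^ r with hX
  refine ⟨X * (S ^ n).toReal, by positivity, fun k u hu => ?_⟩
  set T := eLpNorm (fun x => t k x * u x) p volume with hT
  have hcube : ∀ m : Fin n → ℤ, ∫⁻ x in dyadicCube n 0 m,
      ENNReal.ofReal (|u x| ^ r * Real.exp (-(n * (α₃ + 1) * ‖x‖))) ≤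
      ENNReal.ofReal (X * 2 ^ (|α₁| * k)) * T ^ r *
        ∏ i, ENNReal.ofReal (Real.exp (-((m i).natAbs : ℝ))) := by
    intro m
    set J : ℕ := ∑ i, (m i).natAbs with hJ
    have hmJ : ∀ i, |m i| ≤ J := by
      intro i
      rw [Int.abs_eq_natAbs]
      exact_mod_cast Finset.single_le_sum (f := fun i => (m i).natAbs) (fun _ _ => Nat.zero_le _)
        (Finset.mem_univ i)
    have hexp : ∀ x ∈ dyadicCube n 0 m, Real.exp (-(n * (α₃ + 1) * ‖x‖)) ≤
        Real.exp ((α₃ + 1) * n) * Real.exp (-((α₃ + 1) * J)) := by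
      intro x hx
      rw [← Real.exp_add]
      apply Real.exp_le_exp.2
      have h1 : ∀ i, ((m i).natAbs : ℝ) - 1 ≤ ‖x‖ := by
        intro i
        have hxi := norm_le_pi_norm x i
        rw [cube_eq] at hx
        have ha := hx.1 i
        have hb := hx.2 i
        simp only [] at ha hb
        rw [Nat.cast_natAbs, Int.cast_abs]
        rw [Real.norm_eq_abs] at hxi
        have hc : |(m i : ℝ)| ≤ |x i| + 1 := by
          rw [abs_le]
          constructor
          · linarith [neg_abs_le (x i)]
          · linarith [le_abs_self (x i)]
        linarith
      have h2 : (J : ℝ) - n ≤ n * ‖x‖ := by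
        have := Finset.sum_le_sum (fun i (_ : i ∈ Finset.univ) => h1 i)
        simpa [hJ] using this
      nlinarith
    calc _ ≤ ∫⁻ x in dyadicCube n 0 m, ENNReal.ofReal (|u x| ^ r) *
          ENNReal.ofReal (Real.exp ((α₃ + 1) * n) * Real.exp (-((α₃ + 1) * J))) := by
          refine setLIntegral_mono' ?_ fun x hx => ?_
          · rw [cube_eq]; exact measurableSet_Icc
          · rw [← ENNReal.ofReal_mul (by positivity)]
            refine ENNReal.ofReal_le_ofReal ?_
            gcongr
            exact hexp x hx
      _ = (∫⁻ x in dyadicCube n 0 m, ENNReal.ofReal (|u x| ^ r)) *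
          ENNReal.ofReal (Real.exp ((α₃ + 1) * n) * Real.exp (-((α₃ + 1) * J))) := by
          rw [lintegral_mul_const]
          exact ((continuous_abs.measurable.comp hu).pow_const r).ennreal_ofReal
      _ ≤ (ENNReal.ofReal (D * 2 ^ (|α₁| * k) * (2 ^ α₃) ^ J) * T) ^ r *
          ENNReal.ofReal (Real.exp ((α₃ + 1) * n) * Real.exp (-((α₃ + 1) * J))) := by
          gcongr
          refine (cube_eLpNorm hr0 hr (ht.1.1 k) (ht.1.2.1 k) hu m).trans ?_
          gcongr
          exact hDb k J m hmJ
      _ = ENNReal.ofReal ((D * 2 ^ (|α₁| * k) * (2 ^ α₃) ^ J) ^ r *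
          (Real.exp ((α₃ + 1) * n) * Real.exp (-((α₃ + 1) * J)))) * T ^ r := by
          rw [ENNReal.mul_rpow_of_nonneg _ _ hr0.le,
            ENNReal.ofReal_rpow_of_nonneg (by positivity) hr0.le,
            ENNReal.ofReal_mul (p := (D * 2 ^ (|α₁| * k) * (2 ^ α₃) ^ J) ^ r) (by positivity)]
          ring
      _ ≤ ENNReal.ofReal (X * 2 ^ (|α₁| * k) * Real.exp (-J)) * T ^ r := by
          refine mul_le_mul' (ENNReal.ofReal_le_ofReal ?_) le_rfl
          have e1 : (D * 2 ^ (|α₁| * k) * (2 ^ α₃) ^ J) ^ r =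
              D ^ r * (2 ^ (|α₁| * k)) ^ r * ((2 ^ α₃) ^ J) ^ r := by
            rw [Real.mul_rpow (by positivity) (by positivity),
              Real.mul_rpow (by positivity) (by positivity)]
          have e2 : ((2 : ℝ) ^ (|α₁| * k)) ^ r ≤ 2 ^ (|α₁| * k) :=
            Real.rpow_le_self_of_one_le (Real.one_le_rpow (by norm_num) (by positivity)) hr1
          have e3 : (((2 : ℝ) ^ α₃) ^ J) ^ r ≤ Real.exp (α₃ * J) := by
            refine (Real.rpow_le_self_of_one_le
              (one_le_pow₀ (Real.one_le_rpow (by norm_num) hα₃)) hr1).trans ?_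
            rw [mul_comm, Real.exp_nat_mul]
            gcongr
            rw [Real.rpow_def_of_pos (by norm_num)]
            apply Real.exp_le_exp.2
            have := Real.log_two_lt_d9
            nlinarith
          rw [e1]
          calc _ ≤ D ^ r * 2 ^ (|α₁| * k) * Real.exp (α₃ * J) *
                (Real.exp ((α₃ + 1) * n) * Real.exp (-((α₃ + 1) * J))) :=
                mul_le_mul_of_nonneg_right (mul_le_mul (mul_le_mul_of_nonneg_left e2
                  (by positivity)) e3 (by positivity) (by positivity)) (by positivity)
            _ = X * 2 ^ (|α₁| * k) * (Real.exp (α₃ * J) * Real.exp (-((α₃ + 1) * J))) := by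
                rw [hX]; ring
            _ = _ := by rw [← Real.exp_add]; congr 2; ring
      _ = _ := by
          rw [← ENNReal.ofReal_prod_of_nonneg (fun _ _ => by positivity), ← Real.exp_sum,
            ENNReal.ofReal_mul (by positivity)]
          have : ∑ i, -((m i).natAbs : ℝ) = -(J : ℝ) := by rw [hJ]; push_cast; simp
          rw [this]; ring
  calc _ = ∫⁻ x in ⋃ m : Fin n → ℤ, dyadicCube n 0 m,
        ENNReal.ofReal (|u x| ^ r * Real.exp (-(n * (α₃ + 1) * ‖x‖))) := by
        rw [cube_cover, Measure.restrict_univ]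
    _ ≤ ∑' m : Fin n → ℤ, ∫⁻ x in dyadicCube n 0 m,
        ENNReal.ofReal (|u x| ^ r * Real.exp (-(n * (α₃ + 1) * ‖x‖))) := lintegral_iUnion_le _ _
    _ ≤ ∑' m : Fin n → ℤ, ENNReal.ofReal (X * 2 ^ (|α₁| * k)) * T ^ r *
        ∏ i, ENNReal.ofReal (Real.exp (-((m i).natAbs : ℝ))) := ENNReal.tsum_le_tsum hcube
    _ = ENNReal.ofReal (X * 2 ^ (|α₁| * k)) * T ^ r * S ^ n := by
        rw [ENNReal.tsum_mul_left, tsum_pi_prod (fun z => ENNReal.ofReal (Real.exp (-(z.natAbs : ℝ))))]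
    _ = _ := by
        have hSn : S ^ n ≠ ∞ := ENNReal.pow_ne_top tsum_exp_int
        conv_lhs => rw [← ENNReal.ofReal_toReal hSn]
        rw [show X * (S ^ n).toReal * 2 ^ (|α₁| * k) = X * 2 ^ (|α₁| * k) * (S ^ n).toReal by ring,
          ENNReal.ofReal_mul (p := X * 2 ^ (|α₁| * k)) (by positivity)]
        ring


theorem pow_bound_aux {k n N N' : ℕ} {r a : ℝ} (h : (n + N) * (1 - r) + a + 1 ≤ N') :
    (((2 : ℝ) ^ k)⁻¹) ^ N' * ((2 : ℝ) ^ (k * (n + N))) ^ (1 - r) * 2 ^ (a * k) ≤ (1 / 2) ^ k := by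
  have e1 : (((2 : ℝ) ^ k)⁻¹) ^ N' = 2 ^ (-(k * N' : ℝ)) := by
    rw [Real.rpow_neg (by norm_num), inv_pow, ← pow_mul]
    congr 1; exact_mod_cast (Real.rpow_natCast 2 (k * N')).symm
  have e2 : ((2 : ℝ) ^ (k * (n + N))) ^ (1 - r) = 2 ^ ((k * (n + N)) * (1 - r) : ℝ) := by
    rw [Real.rpow_mul (by norm_num)]
    congr 1; exact_mod_cast (Real.rpow_natCast 2 (k * (n + N))).symm
  have e3 : ((1 : ℝ) / 2) ^ k = 2 ^ (-(k : ℝ)) := by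
    rw [Real.rpow_neg (by norm_num), Real.rpow_natCast, one_div, inv_pow]
  rw [e1, e2, e3, ← Real.rpow_add (by norm_num), ← Real.rpow_add (by norm_num)]
  apply Real.rpow_le_rpow_of_exponent_le (by norm_num)
  have hk : (0 : ℝ) ≤ k := Nat.cast_nonneg k
  nlinarith

theorem piece {n : ℕ} {p σ₁ σ₂ : ℝ≥0∞} {α₁ α₂ α₃ : ℝ} (hα₃ : 0 ≤ α₃)
    {t : ℕ → (Fin n → ℝ) → ℝ} (ht : MemX n p σ₁ σ₂ α₁ α₂ α₃ t) {r : ℝ} (hr0 : 0 < r) (hr1 : r < 1)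
    (hr : ENNReal.ofReal r ≤ (σ₁⁻¹ + p⁻¹)⁻¹)
    {φ₀ : (Fin n → ℝ) → ℝ} (hφ : IsTestFun n φ₀) (hint : (∫ x, φ₀ x) = 1) (N N' : ℕ)
    (hA : N * (1 - r) + n * (α₃ + 1) ≤ N') (hB : (n + N) * (1 - r) + |α₁| + 1 ≤ N') :
    ∃ C : ℝ, 0 ≤ C ∧ ∀ (f : Dstrb n) (K : ℝ), Bd f N K → ∀ B : ℝ≥0∞, B ≠ ∞ →
      (∀ k, eLpNorm (fun x => t k x * distConv n f (phiFam n φ₀ k) x) p volume ≤ B) →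
      ∀ (k : ℕ) (θ : TF n) (s : ℝ), Dec N' N' θ.1 s →
        |∫ x, (Qop hφ N' k θ).1 x * distConv n f (phiFam n φ₀ k) x| ≤
          C * K ^ (1 - r) * B.toReal ^ r * s * (1 / 2) ^ k := by
  obtain ⟨c, hc0, hc⟩ := growth hφ N
  obtain ⟨Cq, hCq0, hCq⟩ := Dec_Qop hφ hint N' (Nat.cast_nonneg _) N'
  obtain ⟨D, hD0, hD⟩ := weighted_int hα₃ ht hr0 hr1.le hr
  refine ⟨Cq * c ^ (1 - r) * D, by positivity, fun f K hf B hBt hBk k θ s hs => ?_⟩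
  have hK := hf.1
  have hs0 := hs.nonneg
  set u := distConv n f (phiFam n φ₀ k) with hu
  set A : ℝ := Cq * ((2 ^ k)⁻¹) ^ N' * s * (K * c * 2 ^ (k * (n + N))) ^ (1 - r) with hAdef
  have hA0 : 0 ≤ A := by positivity
  have hucont : Continuous u := continuous_distConv hf (phiFam_test hφ k)
  have pt : ∀ x, |(Qop hφ N' k θ).1 x * u x| ≤
      A * (|u x| ^ r * Real.exp (-(n * (α₃ + 1) * ‖x‖))) := by
    intro x
    have h1 := hCq k θ s hs 0 le_rfl x
    rw [norm_iteratedFDeriv_zero, Real.norm_eq_abs] at h1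
    have h2 := hc f K hf k x
    rw [← hu] at h2
    have h3 : |u x| = |u x| ^ r * |u x| ^ (1 - r) := by
      rw [← Real.rpow_add' (abs_nonneg _) (by norm_num)]; simp
    have h4 : |u x| ^ (1 - r) ≤ (K * c * 2 ^ (k * (n + N))) ^ (1 - r) *
        Real.exp (N * ‖x‖ * (1 - r)) := by
      refine (Real.rpow_le_rpow (abs_nonneg _) h2 (by linarith)).trans ?_
      rw [Real.mul_rpow (by positivity) (by positivity), ← Real.exp_mul]
    have h5 : Real.exp (-(N' * ‖x‖)) * Real.exp (N * ‖x‖ * (1 - r)) ≤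
        Real.exp (-(n * (α₃ + 1) * ‖x‖)) := by
      rw [← Real.exp_add]
      apply Real.exp_le_exp.2
      nlinarith [norm_nonneg x]
    rw [abs_mul]
    calc _ ≤ (Cq * ((2 ^ k)⁻¹) ^ N' * s * Real.exp (-(N' * ‖x‖))) *
          (|u x| ^ r * ((K * c * 2 ^ (k * (n + N))) ^ (1 - r) * Real.exp (N * ‖x‖ * (1 - r)))) := by
          refine mul_le_mul h1 ?_ (abs_nonneg _) (by positivity)
          conv_lhs => rw [h3]
          exact mul_le_mul_of_nonneg_left h4 (by positivity)
      _ = A * (|u x| ^ r * (Real.exp (-(N' * ‖x‖)) * Real.exp (N * ‖x‖ * (1 - r)))) := by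
          rw [hAdef]; ring
      _ ≤ _ := mul_le_mul_of_nonneg_left (mul_le_mul_of_nonneg_left h5 (by positivity)) hA0
  have hI : ∫⁻ x, ENNReal.ofReal ‖(Qop hφ N' k θ).1 x * u x‖ ≤
      ENNReal.ofReal A * (ENNReal.ofReal (D * 2 ^ (|α₁| * k)) * B ^ r) := by
    calc _ ≤ ∫⁻ x, ENNReal.ofReal A *
          ENNReal.ofReal (|u x| ^ r * Real.exp (-(n * (α₃ + 1) * ‖x‖))) := by
          refine lintegral_mono fun x => ?_
          rw [← ENNReal.ofReal_mul hA0]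
          exact ENNReal.ofReal_le_ofReal (pt x)
      _ = ENNReal.ofReal A *
          ∫⁻ x, ENNReal.ofReal (|u x| ^ r * Real.exp (-(n * (α₃ + 1) * ‖x‖))) := by
          rw [lintegral_const_mul' _ _ ENNReal.ofReal_ne_top]
      _ ≤ _ := by
          refine mul_le_mul' le_rfl ((hD k u hucont.measurable).trans ?_)
          exact mul_le_mul' le_rfl (ENNReal.rpow_le_rpow (hBk k) hr0.le)
  have hfin : ENNReal.ofReal A * (ENNReal.ofReal (D * 2 ^ (|α₁| * k)) * B ^ r) ≠ ∞ :=
    ENNReal.mul_ne_top ENNReal.ofReal_ne_top (ENNReal.mul_ne_top ENNReal.ofReal_ne_top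
      (ENNReal.rpow_ne_top_of_nonneg hr0.le hBt))
  have h6 := (norm_integral_le_lintegral_norm (fun x => (Qop hφ N' k θ).1 x * u x)
    (μ := volume)).trans (ENNReal.toReal_mono hfin hI)
  rw [Real.norm_eq_abs] at h6
  refine h6.trans ?_
  rw [ENNReal.toReal_mul, ENNReal.toReal_mul, ENNReal.toReal_ofReal hA0,
    ENNReal.toReal_ofReal (by positivity), ← ENNReal.toReal_rpow]
  have h7 : A * (D * 2 ^ (|α₁| * k) * B.toReal ^ r) =
      (Cq * c ^ (1 - r) * D * K ^ (1 - r) * B.toReal ^ r * s) *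
      ((((2 : ℝ) ^ k)⁻¹) ^ N' * ((2 : ℝ) ^ (k * (n + N))) ^ (1 - r) * 2 ^ (|α₁| * k)) := by
    rw [hAdef, Real.mul_rpow (by positivity) (by positivity), Real.mul_rpow hK hc0]
    ring
  rw [h7]
  exact mul_le_mul_of_nonneg_left (pow_bound_aux hB) (by positivity)

theorem step {n : ℕ} {p σ₁ σ₂ : ℝ≥0∞} {α₁ α₂ α₃ : ℝ} (hα₃ : 0 ≤ α₃)
    {t : ℕ → (Fin n → ℝ) → ℝ} (ht : MemX n p σ₁ σ₂ α₁ α₂ α₃ t) {r : ℝ} (hr0 : 0 < r) (hr1 : r < 1)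
    (hr : ENNReal.ofReal r ≤ (σ₁⁻¹ + p⁻¹)⁻¹)
    {φ₀ : (Fin n → ℝ) → ℝ} (hφ : IsTestFun n φ₀) (hint : (∫ x, φ₀ x) = 1) (N N' : ℕ)
    (hA : N * (1 - r) + n * (α₃ + 1) ≤ N') (hB : (n + N) * (1 - r) + |α₁| + 1 ≤ N') :
    ∃ C : ℝ, 0 ≤ C ∧ ∀ (f : Dstrb n) (K : ℝ), Bd f N K → ∀ B : ℝ≥0∞, B ≠ ∞ →
      (∀ k, eLpNorm (fun x => t k x * distConv n f (phiFam n φ₀ k) x) p volume ≤ B) →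
      Bd f N' (C * K ^ (1 - r) * B.toReal ^ r) := by
  obtain ⟨C, hC0, hC⟩ := piece hα₃ ht hr0 hr1 hr hφ hint N N' hA hB
  refine ⟨C * 2, by positivity, fun f K hf B hBt hBk => ?_⟩
  have hK := hf.1
  refine ⟨by positivity, fun θ hθ s hs => ?_⟩
  have hs0 := hs.nonneg
  set Θ : TF n := ⟨θ, hθ⟩ with hΘ
  obtain ⟨CX, hCX1, hCX⟩ := Dec_Xop hφ hint N (Nat.cast_nonneg _)
  obtain ⟨s', hs'⟩ := exists_Dec hθ N (N + (N' + 1))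
  have hs'0 := hs'.nonneg
  have key : ∀ J : ℕ, |f θ| ≤ K * ((CX * (2 ^ J)⁻¹) ^ (N' + 1) * s') +
      C * 2 * K ^ (1 - r) * B.toReal ^ r * s := by
    intro J
    have e1 : θ = ((Xop hφ J ^ (N' + 1)) Θ).1 +
        ∑ k ∈ Finset.range J, ((Aop hφ (k + 1) - Aop hφ k) (Qop hφ N' k Θ)).1 := by
      have h := congrArg (fun T : Module.End ℝ (TF n) => (T Θ).1) (reproducing hφ N' J)
      simp only [LinearMap.add_apply, LinearMap.sum_apply, Module.End.one_apply,
        Module.End.mul_apply, Submodule.coe_add, Submodule.coe_sum] at h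
      exact h
    have e2 : f θ = f ((Xop hφ J ^ (N' + 1)) Θ).1 +
        ∑ k ∈ Finset.range J, ∫ x, (Qop hφ N' k Θ).1 x * distConv n f (phiFam n φ₀ k) x := by
      conv_lhs => rw [e1]
      rw [map_add, map_sum]
      congr 1
      exact Finset.sum_congr rfl fun k _ => f_Bop hφ hf k _
    rw [e2]
    refine (abs_add_le _ _).trans (add_le_add ?_ ?_)
    · exact hf.2 _ ((Xop hφ J ^ (N' + 1)) Θ).2 _ (hCX J (N' + 1) N Θ s' hs')
    · refine (Finset.abs_sum_le_sum_abs _ _).trans ?_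
      refine (Finset.sum_le_sum fun k _ => hC f K hf B hBt hBk k Θ s hs).trans ?_
      rw [← Finset.mul_sum]
      have h2 : ∑ k ∈ Finset.range J, ((1 : ℝ) / 2) ^ k ≤ 2 := sum_geometric_two_le J
      calc _ ≤ C * K ^ (1 - r) * B.toReal ^ r * s * 2 :=
            mul_le_mul_of_nonneg_left h2 (by positivity)
        _ = _ := by ring
  have lim : Tendsto (fun J : ℕ => K * ((CX * (2 ^ J)⁻¹) ^ (N' + 1) * s') +
      C * 2 * K ^ (1 - r) * B.toReal ^ r * s) atTop
      (𝓝 (K * ((CX * 0) ^ (N' + 1) * s') + C * 2 * K ^ (1 - r) * B.toReal ^ r * s)) := by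
    have h0 : Tendsto (fun J : ℕ => ((2 : ℝ) ^ J)⁻¹) atTop (𝓝 0) := by
      have := tendsto_pow_atTop_nhds_zero_of_lt_one (r := (1 / 2 : ℝ)) (by norm_num) (by norm_num)
      refine this.congr fun J => ?_
      rw [one_div, inv_pow]
    exact ((((h0.const_mul CX).pow (N' + 1)).mul_const s').const_mul K).add_const _
  have := ge_of_tendsto' lim key
  simpa using this

theorem Bd.mono {n : ℕ} {f : Dstrb n} {N N' : ℕ} {K K' : ℝ} (h : Bd f N K) (hN : N ≤ N')
    (hK : K ≤ K') : Bd f N' K' := by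
  refine ⟨h.1.trans hK, fun θ hθ s hs => ?_⟩
  refine (h.2 θ hθ s (hs.mono (by exact_mod_cast hN) hN le_rfl)).trans ?_
  exact mul_le_mul_of_nonneg_right hK hs.nonneg

theorem main_bound {n : ℕ} {p σ₁ σ₂ : ℝ≥0∞} {α₁ α₂ α₃ : ℝ} (hp : 0 < p) (hσ₁ : 0 < σ₁)
    (hα₃ : 0 ≤ α₃)
    {t : ℕ → (Fin n → ℝ) → ℝ} (ht : MemX n p σ₁ σ₂ α₁ α₂ α₃ t)
    {φ₀ : (Fin n → ℝ) → ℝ} (hφ : IsTestFun n φ₀) (hint : (∫ x, φ₀ x) = 1) :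
    ∃ (C : ℝ) (N : ℕ), 0 < C ∧ ∀ (f : Dstrb n) (N₁ : ℕ) (K : ℝ), Bd f N₁ K → ∀ B : ℝ≥0∞, B ≠ ∞ →
      (∀ k, eLpNorm (fun x => t k x * distConv n f (phiFam n φ₀ k) x) p volume ≤ B) →
      Bd f N (C * B.toReal) := by
  obtain ⟨r, hr0, hr1, hr⟩ : ∃ r : ℝ, 0 < r ∧ r < 1 ∧ ENNReal.ofReal r ≤ (σ₁⁻¹ + p⁻¹)⁻¹ := by
    have h0 : 0 < (σ₁⁻¹ + p⁻¹)⁻¹ := by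
      rw [ENNReal.inv_pos]
      exact ENNReal.add_ne_top.2 ⟨ENNReal.inv_ne_top.2 hσ₁.ne', ENNReal.inv_ne_top.2 hp.ne'⟩
    have h1 : min ((σ₁⁻¹ + p⁻¹)⁻¹) (1/2) ≠ ∞ := ne_top_of_le_ne_top (by simp) (min_le_right _ _)
    refine ⟨(min ((σ₁⁻¹ + p⁻¹)⁻¹) (1/2)).toReal, ENNReal.toReal_pos (lt_min h0 (by simp)).ne' h1,
      ?_, ?_⟩
    · have := ENNReal.toReal_mono (by simp) (min_le_right ((σ₁⁻¹ + p⁻¹)⁻¹) ((1:ℝ≥0∞)/2))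
      refine this.trans_lt ?_
      simp; norm_num
    · rw [ENNReal.ofReal_toReal h1]; exact min_le_left _ _
  obtain ⟨N₀, hN₀⟩ := exists_nat_ge ((n * (α₃ + 1) + n + |α₁| + 3) / r)
  rw [div_le_iff₀ hr0] at hN₀
  have cond : ∀ N : ℕ, N₀ ≤ N → N * (1 - r) + n * (α₃ + 1) + 1 ≤ N ∧
      (n + N) * (1 - r) + |α₁| + 1 + 1 ≤ N := by
    intro N hN
    have hN' : (N₀ : ℝ) * r ≤ N * r := by
      apply mul_le_mul_of_nonneg_right _ hr0.le
      exact_mod_cast hN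
    have hn : (0 : ℝ) ≤ n := Nat.cast_nonneg n
    have hnr : 0 ≤ n * r := by positivity
    have hna : 0 ≤ n * α₃ := by positivity
    have := abs_nonneg α₁
    constructor <;> nlinarith
  obtain ⟨C, hC0, hC⟩ := step hα₃ ht hr0 hr1 hr hφ hint N₀ N₀ (by linarith [(cond N₀ le_rfl).1])
    (by linarith [(cond N₀ le_rfl).2])
  refine ⟨C ^ (1 / r) + 1, N₀, by positivity, fun f N₁ K hf B hBt hBk => ?_⟩
  -- descend to level N₀
  have desc : ∀ d : ℕ, (∃ K, Bd f (N₀ + d) K) → ∃ K, Bd f N₀ K := by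
    intro d
    induction d with
    | zero => exact id
    | succ d ih =>
      rintro ⟨K, hK⟩
      have hc := cond (N₀ + (d + 1)) (by omega)
      push_cast at hc
      obtain ⟨C', hC'0, hC'⟩ := step hα₃ ht hr0 hr1 hr hφ hint (N₀ + (d + 1)) (N₀ + d)
        (by push_cast; linarith [hc.1]) (by push_cast; linarith [hc.2])
      exact ih ⟨_, hC' f K hK B hBt hBk⟩
  have hex : ∃ K, Bd f N₀ K := desc N₁ ⟨K, hf.mono (by omega) le_rfl⟩
  set S : Set ℝ := {K | Bd f N₀ K} with hS
  have hSne : S.Nonempty := hex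
  have hSbd : BddBelow S := ⟨0, fun K hK => hK.1⟩
  set κ := sInf S with hκ
  have hκ0 : 0 ≤ κ := le_csInf hSne fun K hK => hK.1
  have hκB : Bd f N₀ κ := by
    refine ⟨hκ0, fun θ hθ s hs => ?_⟩
    rcases hs.nonneg.eq_or_lt with h | h
    · have := hex.choose_spec.2 θ hθ s hs
      rw [← h] at this ⊢
      simpa using this
    · rw [← div_le_iff₀ h]
      refine le_csInf hSne fun K hK => ?_
      rw [div_le_iff₀ h]
      exact hK.2 θ hθ s hs
  have hle : κ ≤ C * κ ^ (1 - r) * B.toReal ^ r := csInf_le hSbd (hC f κ hκB B hBt hBk)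
  refine hκB.mono le_rfl ?_
  rcases hκ0.eq_or_lt with h | h
  · rw [← h]; positivity
  · have h1 : κ ^ r ≤ C * B.toReal ^ r := by
      have h2 : κ = κ ^ r * κ ^ (1 - r) := by rw [← Real.rpow_add h]; simp
      have h3 : 0 < κ ^ (1 - r) := by positivity
      have h4 : κ ^ r * κ ^ (1 - r) ≤ (C * B.toReal ^ r) * κ ^ (1 - r) := by
        rw [← h2]; linarith
      exact le_of_mul_le_mul_right h4 h3
    have h5 : κ ≤ (C * B.toReal ^ r) ^ (1 / r) := by
      have := Real.rpow_le_rpow (by positivity) h1 (by positivity : 0 ≤ 1 / r)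
      rwa [← Real.rpow_mul hκ0, mul_one_div_cancel hr0.ne', Real.rpow_one] at this
    rw [Real.mul_rpow hC0 (by positivity), ← Real.rpow_mul ENNReal.toReal_nonneg,
      mul_one_div_cancel hr0.ne', Real.rpow_one] at h5
    have : 0 ≤ B.toReal := ENNReal.toReal_nonneg
    linarith


theorem toReal_pos_aux {q : ℝ≥0∞} (hq : 0 < q) (hqt : q ≠ ∞) : 0 < q.toReal :=
  ENNReal.toReal_pos hq.ne' hqt

theorem le_lqNorm {q : ℝ≥0∞} (hq : 0 < q) (a : ℕ → ℝ≥0∞) (k : ℕ) : a k ≤ lqNorm q a := by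
  unfold lqNorm
  split_ifs with h
  · exact le_iSup a k
  · have hq' := toReal_pos_aux hq h
    have h1 : a k ^ q.toReal ≤ ∑' k, a k ^ q.toReal := ENNReal.le_tsum k
    have h2 := ENNReal.rpow_le_rpow h1 (by positivity : 0 ≤ 1 / q.toReal)
    rwa [← ENNReal.rpow_mul, mul_one_div_cancel hq'.ne', ENNReal.rpow_one] at h2

theorem lqNorm_le_iff {q : ℝ≥0∞} (hq : 0 < q) (hqt : q ≠ ∞) (a : ℕ → ℝ≥0∞) (ε : ℝ≥0∞) :
    lqNorm q a ≤ ε ↔ ∑' k, a k ^ q.toReal ≤ ε ^ q.toReal := by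
  have hq' := toReal_pos_aux hq hqt
  unfold lqNorm
  rw [if_neg hqt, one_div, ENNReal.rpow_inv_le_iff hq']

theorem lqNorm_fatou {q : ℝ≥0∞} (hq : 0 < q) (a : ℕ → ℝ≥0∞) (b : ℕ → ℕ → ℝ≥0∞) (ε : ℝ≥0∞)
    (h : ∀ k, a k ≤ liminf (fun i => b i k) atTop) (hb : ∀ᶠ i in atTop, lqNorm q (b i) ≤ ε) :
    lqNorm q a ≤ ε := by
  by_cases hqt : q = ∞
  · unfold lqNorm
    rw [if_pos hqt]
    refine iSup_le fun k => (h k).trans ?_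
    refine liminf_le_of_frequently_le' (Eventually.frequently ?_)
    filter_upwards [hb] with i hi
    exact (le_lqNorm hq (b i) k).trans hi
  · have hq' := toReal_pos_aux hq hqt
    rw [lqNorm_le_iff hq hqt]
    have h1 : ∀ k, a k ^ q.toReal ≤ liminf (fun i => b i k ^ q.toReal) atTop := by
      intro k
      refine (ENNReal.rpow_le_rpow (h k) hq'.le).trans (le_of_eq ?_)
      exact OrderIso.liminf_apply (u := fun i => b i k) (ENNReal.orderIsoRpow q.toReal hq')
    calc _ ≤ ∑' k, liminf (fun i => b i k ^ q.toReal) atTop := ENNReal.tsum_le_tsum h1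
      _ ≤ liminf (fun i => ∑' k, b i k ^ q.toReal) atTop := by
          simp only [← lintegral_count]
          exact lintegral_liminf_le (fun i => measurable_of_countable _)
      _ ≤ _ := by
          refine liminf_le_of_frequently_le' (Eventually.frequently ?_)
          filter_upwards [hb] with i hi
          exact (lqNorm_le_iff hq hqt _ _).1 hi

theorem lqNorm_fin {q : ℝ≥0∞} (hq : 0 < q) (a b c : ℕ → ℝ≥0∞) (κ : ℝ≥0∞) (hκ : κ ≠ ∞)
    (h : ∀ k, c k ≤ κ * (a k + b k)) (ha : lqNorm q a ≠ ∞) (hb : lqNorm q b ≠ ∞) :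
    lqNorm q c ≠ ∞ := by
  by_cases hqt : q = ∞
  · have : lqNorm q c ≤ κ * (lqNorm q a + lqNorm q b) := by
      conv_lhs => unfold lqNorm
      rw [if_pos hqt]
      refine iSup_le fun k => (h k).trans ?_
      exact mul_le_mul' le_rfl (add_le_add (le_lqNorm hq a k) (le_lqNorm hq b k))
    exact ne_top_of_le_ne_top (ENNReal.mul_ne_top hκ (ENNReal.add_ne_top.2 ⟨ha, hb⟩)) this
  · have hq' := toReal_pos_aux hq hqt
    have hfin : ∀ d : ℕ → ℝ≥0∞, lqNorm q d ≠ ∞ ↔ ∑' k, d k ^ q.toReal ≠ ∞ := by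
      intro d
      unfold lqNorm
      rw [if_neg hqt]
      constructor
      · intro h1 h2
        rw [h2, ENNReal.top_rpow_of_pos (by positivity)] at h1
        exact h1 rfl
      · intro h1
        exact ENNReal.rpow_ne_top_of_nonneg (by positivity) h1
    rw [hfin] at ha hb ⊢
    have key : ∀ k, c k ^ q.toReal ≤ (κ * 2) ^ q.toReal * (a k ^ q.toReal + b k ^ q.toReal) := by
      intro k
      have h1 : c k ≤ κ * 2 * max (a k) (b k) := by
        refine (h k).trans ?_
        rw [mul_assoc, two_mul]
        exact mul_le_mul' le_rfl (add_le_add (le_max_left _ _) (le_max_right _ _))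
      refine (ENNReal.rpow_le_rpow h1 hq'.le).trans ?_
      rw [ENNReal.mul_rpow_of_nonneg _ _ hq'.le]
      refine mul_le_mul' le_rfl ?_
      rcases le_total (a k) (b k) with h2 | h2
      · rw [max_eq_right h2]; exact le_add_self
      · rw [max_eq_left h2]; exact le_self_add
    refine ne_top_of_le_ne_top ?_ (ENNReal.tsum_le_tsum key)
    rw [ENNReal.tsum_mul_left, ENNReal.tsum_add]
    exact ENNReal.mul_ne_top (ENNReal.rpow_ne_top_of_nonneg hq'.le
      (ENNReal.mul_ne_top hκ (by simp))) (ENNReal.add_ne_top.2 ⟨ha, hb⟩)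

theorem se_le_of_Dec {n N : ℕ} {θ : (Fin n → ℝ) → ℝ} {s : ℝ} (h : Dec N N θ s) :
    seSeminorm n N θ ≤ ENNReal.ofReal ((N + 1) * s) := by
  refine iSup_le fun x => ENNReal.ofReal_le_ofReal ?_
  have h1 : ∑ i ∈ Finset.range (N + 1), ‖iteratedFDeriv ℝ i θ x‖ ≤
      ∑ i ∈ Finset.range (N + 1), s * Real.exp (-(N * ‖x‖)) :=
    Finset.sum_le_sum fun i hi => h i (by simpa [Nat.lt_succ_iff] using hi) x
  rw [Finset.sum_const, Finset.card_range, nsmul_eq_mul] at h1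
  calc _ ≤ Real.exp (N * ‖x‖) * (((N + 1 : ℕ) : ℝ) * (s * Real.exp (-(N * ‖x‖)))) :=
        mul_le_mul_of_nonneg_left h1 (by positivity)
    _ = (N + 1) * s * (Real.exp (N * ‖x‖) * Real.exp (-(N * ‖x‖))) := by push_cast; ring
    _ = _ := by rw [← Real.exp_add]; simp

theorem Dec_of_se {n N : ℕ} {θ : (Fin n → ℝ) → ℝ} (h : seSeminorm n N θ ≠ ∞) :
    Dec N N θ (seSeminorm n N θ).toReal := by
  intro i hi x
  have h1 : Real.exp (N * ‖x‖) * ∑ i ∈ Finset.range (N + 1), ‖iteratedFDeriv ℝ i θ x‖ ≤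
      (seSeminorm n N θ).toReal := by
    rw [← ENNReal.ofReal_le_iff_le_toReal h]
    exact le_iSup (fun x : Fin n → ℝ => ENNReal.ofReal
      (Real.exp (N * ‖x‖) * ∑ i ∈ Finset.range (N + 1), ‖iteratedFDeriv ℝ i θ x‖)) x
  have h2 : ‖iteratedFDeriv ℝ i θ x‖ ≤ ∑ i ∈ Finset.range (N + 1), ‖iteratedFDeriv ℝ i θ x‖ :=
    Finset.single_le_sum (f := fun i => ‖iteratedFDeriv ℝ i θ x‖) (fun _ _ => norm_nonneg _)
      (by simpa [Nat.lt_succ_iff] using hi)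
  rw [Real.exp_neg, ← div_eq_mul_inv, le_div_iff₀ (Real.exp_pos _), mul_comm]
  exact (mul_le_mul_of_nonneg_left h2 (Real.exp_pos _).le).trans h1

theorem se_test {n N : ℕ} {θ : (Fin n → ℝ) → ℝ} (h : IsTestFun n θ) : seSeminorm n N θ ≠ ∞ := by
  obtain ⟨s, hs⟩ := exists_Dec h N N
  exact ne_top_of_le_ne_top ENNReal.ofReal_ne_top (se_le_of_Dec hs)

theorem Bd_of_MemSe {n : ℕ} {f : Dstrb n} (h : MemSe' n f) : ∃ N K, Bd f N K := by
  obtain ⟨C, N, hC, hf⟩ := h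
  refine ⟨N, C * (N + 1), by positivity, fun θ hθ s hs => ?_⟩
  have hs0 := hs.nonneg
  have h1 := (hf θ hθ.1).trans (mul_le_mul' le_rfl (se_le_of_Dec hs))
  rw [← ENNReal.ofReal_mul hC.le, ENNReal.ofReal_le_ofReal_iff (by positivity)] at h1
  linarith

theorem Bd_sub {n : ℕ} {f g : Dstrb n} {N N' : ℕ} {K K' : ℝ} (hf : Bd f N K) (hg : Bd g N' K') :
    Bd (f - g) (max N N') (K + K') := by
  refine ⟨add_nonneg hf.1 hg.1, fun θ hθ s hs => ?_⟩
  have h1 := (hf.mono (le_max_left N N') le_rfl).2 θ hθ s hs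
  have h2 := (hg.mono (le_max_right N N') le_rfl).2 θ hθ s hs
  rw [LinearMap.sub_apply, add_mul]
  exact (abs_sub _ _).trans (add_le_add h1 h2)

theorem se_add {n N : ℕ} {g h : (Fin n → ℝ) → ℝ} (hg : ContDiff ℝ (⊤ : ℕ∞) g)
    (hh : ContDiff ℝ (⊤ : ℕ∞) h) :
    seSeminorm n N (g + h) ≤ seSeminorm n N g + seSeminorm n N h := by
  refine iSup_le fun x => ?_
  refine le_trans ?_ (add_le_add (le_iSup (fun x : Fin n → ℝ => ENNReal.ofReal
      (Real.exp (N * ‖x‖) * ∑ i ∈ Finset.range (N + 1), ‖iteratedFDeriv ℝ i g x‖)) x)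
      (le_iSup (fun x : Fin n → ℝ => ENNReal.ofReal
      (Real.exp (N * ‖x‖) * ∑ i ∈ Finset.range (N + 1), ‖iteratedFDeriv ℝ i h x‖)) x))
  rw [← ENNReal.ofReal_add (by positivity) (by positivity), ← mul_add, ← Finset.sum_add_distrib]
  refine ENNReal.ofReal_le_ofReal (mul_le_mul_of_nonneg_left (Finset.sum_le_sum fun i _ => ?_)
    (by positivity))
  rw [iteratedFDeriv_add_apply (hg.contDiffAt.of_le (by exact_mod_cast le_top))
    (hh.contDiffAt.of_le (by exact_mod_cast le_top))]
  exact norm_add_le _ _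

theorem se_smul {n N : ℕ} {g : (Fin n → ℝ) → ℝ} (hg : ContDiff ℝ (⊤ : ℕ∞) g) (c : ℝ) :
    seSeminorm n N (c • g) = ENNReal.ofReal |c| * seSeminorm n N g := by
  unfold seSeminorm
  rw [ENNReal.mul_iSup]
  congr 1; funext x
  rw [← ENNReal.ofReal_mul (abs_nonneg _)]
  congr 1
  rw [mul_left_comm, Finset.mul_sum _ _ |c|]
  congr 1
  refine Finset.sum_congr rfl fun i _ => ?_
  rw [iteratedFDeriv_const_smul_apply (hg.contDiffAt.of_le (by exact_mod_cast le_top)), norm_smul,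
    Real.norm_eq_abs]

def VN (n N : ℕ) : Submodule ℝ ((Fin n → ℝ) → ℝ) where
  carrier := {g | ContDiff ℝ (⊤ : ℕ∞) g ∧ seSeminorm n N g ≠ ∞}
  add_mem' := fun {a b} ha hb => ⟨ha.1.add hb.1,
    ne_top_of_le_ne_top (ENNReal.add_ne_top.2 ⟨ha.2, hb.2⟩) (se_add ha.1 hb.1)⟩
  zero_mem' := ⟨contDiff_const, se_test (TF n).zero_mem⟩
  smul_mem' := fun c g hg => ⟨contDiff_const.smul hg.1, by
    rw [se_smul hg.1]; exact ENNReal.mul_ne_top ENNReal.ofReal_ne_top hg.2⟩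

theorem TF_le_VN (n N : ℕ) : TF n ≤ VN n N := fun _ h => ⟨h.1, se_test h⟩

theorem extend_dist {n N : ℕ} {K : ℝ} (hK : 0 ≤ K) (l : TF n →ₗ[ℝ] ℝ)
    (hl : ∀ (θ : TF n) (s : ℝ), Dec N N θ.1 s → |l θ| ≤ K * s) :
    ∃ f : Dstrb n, MemSe' n f ∧ ∀ θ : TF n, f θ.1 = l θ := by
  let dom : Submodule ℝ (VN n N) := (TF n).comap (VN n N).subtype
  let l' : dom →ₗ[ℝ] ℝ := l.comp (LinearMap.restrict (VN n N).subtype (p := dom) (q := TF n)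
    (fun x hx => hx))
  obtain ⟨g, hg1, hg2⟩ := exists_extension_of_le_sublinear (E := VN n N) ⟨dom, l'⟩
    (fun x => K * (seSeminorm n N x.1).toReal)
    (by
      intro c hc x
      simp only [Submodule.coe_smul]
      rw [se_smul x.2.1, ENNReal.toReal_mul, ENNReal.toReal_ofReal (abs_nonneg _), abs_of_pos hc]
      ring)
    (by
      intro x y
      rw [← mul_add, ← ENNReal.toReal_add x.2.2 y.2.2]
      refine mul_le_mul_of_nonneg_left (ENNReal.toReal_mono
        (ENNReal.add_ne_top.2 ⟨x.2.2, y.2.2⟩) (se_add x.2.1 y.2.1)) hK)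
    (by
      intro x
      exact (le_abs_self _).trans (hl ⟨x.1.1, x.2⟩ _ (Dec_of_se x.1.2.2)))
  obtain ⟨f, hf⟩ := LinearMap.exists_extend g
  have hfV : ∀ x : VN n N, f x.1 = g x := fun x => by rw [← hf]; rfl
  refine ⟨f, ⟨K + 1, N, by positivity, fun h hh => ?_⟩, fun θ => ?_⟩
  · by_cases hfin : seSeminorm n N h = ∞
    · rw [hfin, ENNReal.mul_top (by simpa using by positivity)]; exact le_top
    · have h1 := hg2 ⟨h, hh, hfin⟩
      have h2 := hg2 (-⟨h, hh, hfin⟩)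
      rw [map_neg] at h2
      rw [← hfV] at h1 h2
      have h3 : seSeminorm n N (-h) = seSeminorm n N h := by
        have := se_smul (N := N) hh (-1)
        simpa using this
      simp only [Submodule.coe_neg] at h1 h2
      rw [h3] at h2
      have h4 : |f h| ≤ (K + 1) * (seSeminorm n N h).toReal := by
        have : 0 ≤ (seSeminorm n N h).toReal := ENNReal.toReal_nonneg
        rw [abs_le]; constructor <;> linarith
      refine (ENNReal.ofReal_le_ofReal h4).trans (le_of_eq ?_)
      rw [ENNReal.ofReal_mul (by positivity), ENNReal.ofReal_toReal hfin]
  · have h1 := hfV ⟨θ.1, TF_le_VN n N θ.2⟩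
    have h2 := hg1 ⟨⟨θ.1, TF_le_VN n N θ.2⟩, θ.2⟩
    exact h1.trans h2

/-- Lemma 3.4, `B^{φ₀}_{p,q}({t_k})` is complete and continuously
embedded into `S'_e`; in particular the displayed duality estimate holds. -/
theorem besov_complete_and_embedded (n : ℕ) (p q σ₁ σ₂ : ℝ≥0∞) (α₁ α₂ α₃ : ℝ)
    (hp : 0 < p) (hq : 0 < q) (hσ₁ : 0 < σ₁) (hσ₂ : 0 < σ₂) (hα₃ : 0 ≤ α₃)
    (t : ℕ → (Fin n → ℝ) → ℝ) (ht : MemX n p σ₁ σ₂ α₁ α₂ α₃ t)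
    (φ₀ : (Fin n → ℝ) → ℝ) (hφ₀ : IsTestFun n φ₀) (hint : (∫ x, φ₀ x) = 1) :
    (∃ (C : ℝ) (N L : ℕ), 0 < C ∧
      ∀ f : Dstrb n, MemSe' n f → besovNorm n p q t φ₀ f ≠ ∞ →
        ∀ θ : (Fin n → ℝ) → ℝ, IsTestFun n θ →
          ENNReal.ofReal |f θ| ≤
            ENNReal.ofReal C * besovNorm n p q t φ₀ f *
              ⨆ x : Fin n → ℝ, ENNReal.ofReal
                ((∑ i ∈ Finset.range (L + 1), ‖iteratedFDeriv ℝ i θ x‖) *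
                  Real.exp (N * ‖x‖))) ∧
    (∀ F : ℕ → Dstrb n,
      (∀ j, MemSe' n (F j) ∧ besovNorm n p q t φ₀ (F j) ≠ ∞) →
      (∀ ε : ℝ, 0 < ε → ∃ J : ℕ, ∀ j₁ j₂ : ℕ, J ≤ j₁ → J ≤ j₂ →
        besovNorm n p q t φ₀ (F j₁ - F j₂) < ENNReal.ofReal ε) →
      ∃ f : Dstrb n, MemSe' n f ∧ besovNorm n p q t φ₀ f ≠ ∞ ∧
        Filter.Tendsto (fun j => besovNorm n p q t φ₀ (F j - f))
          Filter.atTop (nhds 0)) := by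
  obtain ⟨C, N, hC, hmain⟩ := main_bound hp hσ₁ hα₃ ht hφ₀ hint
  have main2 : ∀ f : Dstrb n, (∃ N K, Bd f N K) → besovNorm n p q t φ₀ f ≠ ∞ →
      Bd f N (C * (besovNorm n p q t φ₀ f).toReal) := by
    rintro f ⟨N₁, K, hf⟩ hfin
    exact hmain f N₁ K hf _ hfin fun k => le_lqNorm hq
      (fun k => eLpNorm (fun x => t k x * distConv n f (phiFam n φ₀ k) x) p volume) k
  constructor
  · refine ⟨C, N, N, hC, fun f hf hfin θ hθ => ?_⟩
    have h1 := main2 f (Bd_of_MemSe hf) hfin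
    have h2 := h1.2 θ hθ _ (Dec_of_se (se_test hθ))
    have h3 : (⨆ x : Fin n → ℝ, ENNReal.ofReal
        ((∑ i ∈ Finset.range (N + 1), ‖iteratedFDeriv ℝ i θ x‖) * Real.exp (N * ‖x‖))) =
        seSeminorm n N θ := by
      unfold seSeminorm
      congr 1; funext x; rw [mul_comm]
    rw [h3]
    refine (ENNReal.ofReal_le_ofReal h2).trans (le_of_eq ?_)
    rw [ENNReal.ofReal_mul (by positivity), ENNReal.ofReal_mul hC.le, ENNReal.ofReal_toReal hfin,
      ENNReal.ofReal_toReal (se_test hθ)]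
  · intro F hF hcau
    have hFB : ∀ j, ∃ N K, Bd (F j) N K := fun j => Bd_of_MemSe (hF j).1
    have hdB : ∀ i j, ∃ N K, Bd (F i - F j) N K := by
      intro i j
      obtain ⟨_, _, h1⟩ := hFB i
      obtain ⟨_, _, h2⟩ := hFB j
      exact ⟨_, _, Bd_sub h1 h2⟩
    have hdiff : ∀ ε : ℝ, 0 < ε → ∃ J : ℕ, ∀ i j : ℕ, J ≤ i → J ≤ j →
        Bd (F i - F j) N (C * ε) := by
      intro ε hε
      obtain ⟨J, hJ⟩ := hcau ε hε
      refine ⟨J, fun i j hi hj => ?_⟩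
      have h1 := hJ i j hi hj
      refine (main2 _ (hdB i j) h1.ne_top).mono le_rfl ?_
      refine mul_le_mul_of_nonneg_left ?_ hC.le
      exact ENNReal.toReal_le_of_le_ofReal hε.le h1.le
    -- pointwise limits on test functions
    have hlim : ∀ θ : TF n, ∃ a : ℝ, Tendsto (fun j => F j θ.1) atTop (𝓝 a) := by
      intro θ
      obtain ⟨s, hs⟩ := exists_Dec θ.2 N N
      have hs0 := hs.nonneg
      refine cauchySeq_tendsto_of_complete (Metric.cauchySeq_iff.2 fun ε hε => ?_)
      obtain ⟨J, hJ⟩ := hdiff (ε / (C * (s + 1))) (by positivity)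
      refine ⟨J, fun i hi j hj => ?_⟩
      have h1 := (hJ i j hi hj).2 θ.1 θ.2 s hs
      rw [Real.dist_eq]
      rw [LinearMap.sub_apply] at h1
      refine h1.trans_lt ?_
      have h2 : C * (ε / (C * (s + 1))) * s = ε * (s / (s + 1)) := by field_simp
      rw [h2]
      have h3 : s / (s + 1) < 1 := by rw [div_lt_one (by positivity)]; linarith
      nlinarith
    choose lf hlf using hlim
    let l : TF n →ₗ[ℝ] ℝ := linearMapOfTendsto lf (fun j => (F j).comp (TF n).subtype)
      (tendsto_pi_nhds.2 fun θ => hlf θ)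
    have hl : ∀ θ : TF n, l θ = lf θ := fun θ => rfl
    obtain ⟨J₁, hJ₁⟩ := hdiff 1 one_pos
    have hFJ := main2 (F J₁) (hFB J₁) (hF J₁).2
    obtain ⟨f, hfS, hfl⟩ := extend_dist (N := N)
      (K := C * 1 + C * (besovNorm n p q t φ₀ (F J₁)).toReal) (by positivity) l (by
        intro θ s hs
        rw [hl]
        refine le_of_tendsto (hlf θ).abs ?_
        filter_upwards [eventually_ge_atTop J₁] with j hj
        have h1 := (hJ₁ j J₁ hj le_rfl).2 θ.1 θ.2 s hs
        have h2 := hFJ.2 θ.1 θ.2 s hs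
        rw [LinearMap.sub_apply] at h1
        have h3 : F j θ.1 = (F j θ.1 - F J₁ θ.1) + F J₁ θ.1 := by ring
        rw [h3, add_mul]
        exact (abs_add_le _ _).trans (add_le_add h1 h2))
    have hconv : ∀ θ, IsTestFun n θ → Tendsto (fun j => F j θ) atTop (𝓝 (f θ)) := by
      intro θ hθ
      have h1 := hfl ⟨θ, hθ⟩
      rw [hl] at h1
      have h2 := hlf ⟨θ, hθ⟩
      rw [← h1] at h2
      exact h2
    have hfatou : ∀ (j : ℕ) (ε : ℝ≥0∞),
        (∀ᶠ i in atTop, besovNorm n p q t φ₀ (F j - F i) ≤ ε) →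
        besovNorm n p q t φ₀ (F j - f) ≤ ε := by
      intro j ε hε
      refine lqNorm_fatou hq _ (fun i k => eLpNorm (fun x => t k x *
        distConv n (F j - F i) (phiFam n φ₀ k) x) p volume) ε (fun k => ?_) hε
      refine Lp.eLpNorm_lim_le_liminf_eLpNorm (fun i => ?_) _ (Eventually.of_forall fun x => ?_)
      · obtain ⟨_, _, h1⟩ := hdB j i
        exact ((ht.1.1 k).mul
          (continuous_distConv h1 (phiFam_test hφ₀ k)).measurable).aestronglyMeasurable
      · refine Tendsto.const_mul _ ?_
        have h1 := hconv _ (isTestFun_conv (phiFam_test hφ₀ k) x)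
        exact h1.const_sub (F j fun y => phiFam n φ₀ k (x - y))
    have hsmall : ∀ ε : ℝ, 0 < ε → ∃ J : ℕ, ∀ j, J ≤ j →
        besovNorm n p q t φ₀ (F j - f) ≤ ENNReal.ofReal ε := by
      intro ε hε
      obtain ⟨J, hJ⟩ := hcau ε hε
      refine ⟨J, fun j hj => hfatou j _ ?_⟩
      filter_upwards [eventually_ge_atTop J] with i hi
      exact (hJ j i hj hi).le
    refine ⟨f, hfS, ?_, ?_⟩
    · obtain ⟨J, hJ⟩ := hsmall 1 one_pos
      have hJ := hJ J le_rfl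
      obtain ⟨_, _, b1⟩ := hFB J
      obtain ⟨_, _, b2⟩ := Bd_of_MemSe hfS
      have b3 := Bd_sub b1 b2
      refine lqNorm_fin hq
        (fun k => eLpNorm (fun x => t k x * distConv n (F J) (phiFam n φ₀ k) x) p volume)
        (fun k => eLpNorm (fun x => t k x * distConv n (F J - f) (phiFam n φ₀ k) x) p volume) _
        (LpAddConst p) (LpAddConst_lt_top p).ne (fun k => ?_) (hF J).2
        (ne_top_of_le_ne_top ENNReal.ofReal_ne_top hJ)
      refine le_trans (le_of_eq ?_) (eLpNorm_sub_le'
        ((ht.1.1 k).mul (continuous_distConv b1 (phiFam_test hφ₀ k)).measurable).aestronglyMeasurable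
        ((ht.1.1 k).mul (continuous_distConv b3 (phiFam_test hφ₀ k)).measurable).aestronglyMeasurable
        p)
      congr 1
      funext x
      simp only [Pi.sub_apply, Pi.mul_apply, distConv, LinearMap.sub_apply]
      ring
    · rw [ENNReal.tendsto_atTop_zero]
      intro ε hε
      obtain ⟨δ, hδ0, hδ⟩ : ∃ δ : ℝ, 0 < δ ∧ ENNReal.ofReal δ ≤ ε := by
        rcases eq_or_ne ε ∞ with h | h
        · exact ⟨1, one_pos, h ▸ le_top⟩
        · exact ⟨ε.toReal, ENNReal.toReal_pos hε.ne' h, by rw [ENNReal.ofReal_toReal h]⟩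
      obtain ⟨J, hJ⟩ := hsmall δ hδ0
      exact ⟨J, fun j hj => (hJ j hj).trans hδ⟩
end
end
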